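/- arXiv:1804.01765 — 3 statements merged into one kernel-verified Lean document; each statement's English description precedes it below -/
import Mathlib

section
/- Let N = b^m with b prime, let α > 1, let (γ_u)_{u ⊆ [s]} be positive weights, and let 0 ≤ w_1 ≤ ⋯ ≤ w_s be integers. Suppose z_1, …, z_s are chosen by the reduced SCS algorithm (each z_d minimizing the squared worst-case error over the reduced search space Z_{N,w_d}, the other later components being fixed to the values of an initial vector z^0). Then for every λ ∈ (1/α, 1], the squared worst-case error of the resulting lattice rule with generating vector (b^{w_1} z_1, …, b^{w_s} z_s) satisfies e²_{N,s} ≤ ( Σ_{d=1}^s Σ_{u ⊆ [s], d ∈ u} γ_u^λ · 2(2ζ(αλ))^{|u|} / b^{max(0, m−w_d)} )^{1/λ}. -/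
/-- The Riemann zeta function for real arguments greater than one, as a series. -/
noncomputable def rzeta (x : ℝ) : ℝ := ∑' n : ℕ, ((n : ℝ) + 1) ^ (-x)

/-- Squared worst-case error of the lattice rule with `N` points and generating
vector `ξ` in the weighted Korobov space with smoothness `α` and weights `γ`. -/
noncomputable def korobovErrSq (N s : ℕ) (α : ℝ) (γ : Finset (Fin s) → ℝ)
    (ξ : Fin s → ℤ) : ℝ :=
  ∑ u ∈ Finset.univ.powerset.filter (fun u => u ≠ ∅), γ u *
    ∑' h : {h : Fin s → ℤ //
        (∀ j, j ∈ u ↔ h j ≠ 0) ∧ ((N : ℤ) ∣ ∑ j ∈ u, h j * ξ j)},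
      ∏ j ∈ u, |((h.1 j : ℤ) : ℝ)| ^ (-α)

/-- The reduced search space `Z_{N,w}` for `N = b^m` and reduction index `w`. -/
def reducedSearch (b m w : ℕ) : Set ℕ :=
  if w < m then {z | 1 ≤ z ∧ z < b ^ (m - w) ∧ Nat.gcd z (b ^ m) = 1} else {1}

open scoped ENNReal

noncomputable def gE (β : ℝ) (k : ℤ) : ℝ≥0∞ := ENNReal.ofReal (|(k : ℝ)| ^ (-β))

noncomputable def fE {s : ℕ} (u : Finset (Fin s)) (β : ℝ) (j : Fin s) (k : ℤ) : ℝ≥0∞ :=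
  if j ∈ u then gE β k else if k = 0 then 1 else 0

noncomputable def EE {s : ℕ} (N : ℕ) (u : Finset (Fin s)) (β : ℝ) (ξ : Fin s → ℤ) : ℝ≥0∞ :=
  ∑' h : Fin s → ℤ, if (N : ℤ) ∣ ∑ j, h j * ξ j then ∏ j, fE u β j (h j) else 0

lemma gE_zero {β : ℝ} (hβ : 0 < β) : gE β 0 = 0 := by
  simp [gE, Real.zero_rpow (neg_ne_zero.mpr hβ.ne')]

lemma tsum_gE {β : ℝ} (hβ : 1 < β) : ∑' k : ℤ, gE β k = ENNReal.ofReal (2 * rzeta β) := by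
  have hs : Summable (fun n : ℕ => ((n : ℝ) + 1) ^ (-β)) := by
    have h := Real.summable_nat_rpow.mpr (show -β < -1 by linarith)
    have := (summable_nat_add_iff 1).mpr h
    simpa using this
  have h1 : ∑' n : ℕ, ENNReal.ofReal (((n : ℝ) + 1) ^ (-β)) = ENNReal.ofReal (rzeta β) :=
    (ENNReal.ofReal_tsum_of_nonneg (fun n => by positivity) hs).symm
  have h2 : HasSum (fun n : ℕ => ENNReal.ofReal (((n : ℝ) + 1) ^ (-β)))
      (ENNReal.ofReal (rzeta β)) := h1 ▸ ENNReal.summable.hasSum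
  have hr : 0 ≤ rzeta β := tsum_nonneg (fun n => by positivity)
  have h4 : HasSum (fun n : ℕ => gE β (-((n : ℤ) + 1))) (ENNReal.ofReal (rzeta β)) := by
    convert h2 using 2 with n
    simp only [gE]
    congr 2
    push_cast
    rw [abs_neg, abs_of_nonneg (by positivity)]
  have h3 : ∑' n : ℕ, gE β n = ENNReal.ofReal (rzeta β) := by
    rw [tsum_eq_zero_add' ENNReal.summable]
    rw [show ((0 : ℕ) : ℤ) = 0 from rfl, gE_zero (by linarith), zero_add, ← h1]
    congr 1
    ext n
    simp only [gE]
    congr 2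
    push_cast
    rw [abs_of_nonneg (by positivity)]
  have h5 : HasSum (fun n : ℕ => gE β n) (ENNReal.ofReal (rzeta β)) :=
    h3 ▸ ENNReal.summable.hasSum
  rw [(HasSum.of_nat_of_neg_add_one h5 h4).tsum_eq, two_mul, ENNReal.ofReal_add hr hr]

lemma tsum_pi_prod {n : ℕ} (f : Fin n → ℤ → ℝ≥0∞) :
    ∑' h : Fin n → ℤ, ∏ j, f j (h j) = ∏ j, ∑' k, f j k := by
  induction n with
  | zero => simp
  | succ n ih =>
    rw [← (Fin.consEquiv (fun _ : Fin (n+1) => ℤ)).tsum_eq, ENNReal.tsum_prod', Fin.prod_univ_succ,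
      ← ih, ← ENNReal.tsum_mul_right]
    congr 1
    ext k
    rw [← ENNReal.tsum_mul_left]
    congr 1
    ext h
    simp [Fin.consEquiv, Fin.prod_univ_succ]

lemma rpow_finsum_le {ι : Type*} (s : Finset ι) (f : ι → ℝ≥0∞) {p : ℝ} (hp : 0 < p) (hp1 : p ≤ 1) :
    (∑ i ∈ s, f i) ^ p ≤ ∑ i ∈ s, f i ^ p := by
  classical
  induction s using Finset.induction_on with
  | empty => simp [hp]
  | insert a s ha ih =>
    rw [Finset.sum_insert ha, Finset.sum_insert ha]
    exact (ENNReal.rpow_add_le_add_rpow _ _ hp.le hp1).trans (by gcongr)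

lemma rpow_tsum_le {ι : Type*} (f : ι → ℝ≥0∞) {p : ℝ} (hp : 0 < p) (hp1 : p ≤ 1) :
    (∑' i, f i) ^ p ≤ ∑' i, f i ^ p := by
  rw [← ENNReal.le_rpow_inv_iff hp, ENNReal.tsum_eq_iSup_sum]
  refine iSup_le fun s => ?_
  rw [ENNReal.le_rpow_inv_iff hp]
  exact (rpow_finsum_le s f hp hp1).trans (ENNReal.sum_le_tsum s)

lemma gE_rpow (α : ℝ) {p : ℝ} (hp : 0 < p) (k : ℤ) : gE α k ^ p = gE (α * p) k := by
  unfold gE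
  rw [ENNReal.ofReal_rpow_of_nonneg (by positivity) hp.le, ← Real.rpow_mul (abs_nonneg _), neg_mul]

lemma fE_rpow {s : ℕ} (u : Finset (Fin s)) (α : ℝ) {p : ℝ} (hp : 0 < p) (j : Fin s) (k : ℤ) :
    fE u α j k ^ p = fE u (α * p) j k := by
  unfold fE
  split_ifs <;> simp [gE_rpow, hp]

lemma EE_rpow_le {s : ℕ} (N : ℕ) (u : Finset (Fin s)) (α : ℝ) (ξ : Fin s → ℤ) {p : ℝ}
    (hp : 0 < p) (hp1 : p ≤ 1) : EE N u α ξ ^ p ≤ EE N u (α * p) ξ := by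
  unfold EE
  refine (rpow_tsum_le _ hp hp1).trans (ENNReal.tsum_le_tsum fun h => ?_)
  split_ifs
  · rw [← ENNReal.prod_rpow_of_nonneg hp.le]
    simp [fE_rpow, hp]
  · simp [hp]

lemma tsum_fE {s : ℕ} (u : Finset (Fin s)) {β : ℝ} (hβ : 1 < β) (j : Fin s) :
    ∑' k, fE u β j k = if j ∈ u then ENNReal.ofReal (2 * rzeta β) else 1 := by
  unfold fE
  split_ifs
  · exact tsum_gE hβ
  · simp

lemma EE_ne_top {s : ℕ} (N : ℕ) (u : Finset (Fin s)) {β : ℝ} (hβ : 1 < β) (ξ : Fin s → ℤ) :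
    EE N u β ξ ≠ ⊤ := by
  have : EE N u β ξ ≤ ∏ j, ∑' k, fE u β j k := by
    rw [← tsum_pi_prod]
    refine ENNReal.tsum_le_tsum fun h => ?_
    split_ifs <;> simp
  refine ne_top_of_le_ne_top ?_ this
  refine ENNReal.prod_ne_top fun j _ => ?_
  rw [tsum_fE u hβ]
  split_ifs
  · exact ENNReal.ofReal_ne_top
  · simp

lemma real_inner_eq {s : ℕ} (N : ℕ) (u : Finset (Fin s)) {α : ℝ} (hα : 1 < α) (ξ : Fin s → ℤ) :
    ∑' h : {h : Fin s → ℤ //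
        (∀ j, j ∈ u ↔ h j ≠ 0) ∧ ((N : ℤ) ∣ ∑ j ∈ u, h j * ξ j)},
      ∏ j ∈ u, |((h.1 j : ℤ) : ℝ)| ^ (-α) = (EE N u α ξ).toReal := by
  classical
  have hfin : ∀ j k, fE u α j k ≠ ⊤ := by
    intro j k
    unfold fE gE
    split_ifs <;> simp
  unfold EE
  rw [ENNReal.tsum_toReal_eq]
  swap
  · intro h
    split_ifs
    · exact ENNReal.prod_ne_top fun j _ => hfin _ _
    · simp
  refine (tsum_subtype {h : Fin s → ℤ | (∀ j, j ∈ u ↔ h j ≠ 0) ∧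
    ((N : ℤ) ∣ ∑ j ∈ u, h j * ξ j)} (fun h => ∏ j ∈ u, |((h j : ℤ) : ℝ)| ^ (-α))).trans ?_
  congr 1
  ext h
  by_cases hu : ∀ j, j ∈ u ↔ h j ≠ 0
  · have hsum : ∑ j ∈ u, h j * ξ j = ∑ j, h j * ξ j := by
      apply Finset.sum_subset (Finset.subset_univ _)
      intro j _ hj
      have : h j = 0 := by
        by_contra h0
        exact hj ((hu j).mpr h0)
      simp [this]
    have hprod : (∏ j, fE u α j (h j)).toReal = ∏ j ∈ u, |((h j : ℤ) : ℝ)| ^ (-α) := by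
      rw [ENNReal.toReal_prod, ← Finset.prod_subset (Finset.subset_univ u)]
      · refine Finset.prod_congr rfl fun j hj => ?_
        simp only [fE, gE, hj, if_true]
        rw [ENNReal.toReal_ofReal (by positivity)]
      · intro j _ hj
        have : h j = 0 := by
          by_contra h0
          exact hj ((hu j).mpr h0)
        simp [fE, hj, this]
    by_cases hd : (N : ℤ) ∣ ∑ j, h j * ξ j
    · rw [Set.indicator_of_mem (by exact ⟨hu, hsum ▸ hd⟩), if_pos hd, hprod]
    · rw [Set.indicator_of_notMem (fun hh => hd (hsum ▸ hh.2)), if_neg hd]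
      simp
  · rw [Set.indicator_of_notMem (fun hh => hu hh.1)]
    have : ∏ j, fE u α j (h j) = 0 := by
      push Not at hu
      obtain ⟨j, hj⟩ := hu
      apply Finset.prod_eq_zero (Finset.mem_univ j)
      rcases hj with ⟨h1, h2⟩ | ⟨h1, h2⟩
      · simp [fE, h1, h2, gE_zero (show 0 < α by linarith)]
      · simp [fE, h1, h2]
    simp [this]

noncomputable def errE {s : ℕ} (N : ℕ) (α : ℝ) (γ : Finset (Fin s) → ℝ) (ξ : Fin s → ℤ) : ℝ≥0∞ :=
  ∑ u ∈ Finset.univ.powerset.filter (fun u => u ≠ ∅), ENNReal.ofReal (γ u) * EE N u α ξ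

lemma errE_ne_top {s : ℕ} (N : ℕ) {α : ℝ} (hα : 1 < α) (γ : Finset (Fin s) → ℝ) (ξ : Fin s → ℤ) :
    errE N α γ ξ ≠ ⊤ :=
  ENNReal.sum_ne_top.mpr fun u _ => ENNReal.mul_ne_top ENNReal.ofReal_ne_top (EE_ne_top N u hα ξ)

lemma korobov_eq {s : ℕ} (N : ℕ) {α : ℝ} (hα : 1 < α) (γ : Finset (Fin s) → ℝ)
    (hγ : ∀ u, 0 < γ u) (ξ : Fin s → ℤ) :
    korobovErrSq N s α γ ξ = (errE N α γ ξ).toReal := by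
  unfold korobovErrSq errE
  rw [ENNReal.toReal_sum]
  · refine Finset.sum_congr rfl fun u _ => ?_
    rw [real_inner_eq N u hα, ENNReal.toReal_mul, ENNReal.toReal_ofReal (hγ u).le]
  · exact fun u _ => ENNReal.mul_ne_top ENNReal.ofReal_ne_top (EE_ne_top N u hα ξ)

lemma count_le (b M t : ℕ) (ht : t ≤ M) (Y : Finset ℕ) (hY : ∀ y ∈ Y, y < b ^ M)
    (hc : ∀ y ∈ Y, ∀ y' ∈ Y, y ≡ y' [MOD b ^ (M - t)]) : Y.card ≤ b ^ t := by
  rw [← Finset.card_range (b ^ t)]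
  apply Finset.card_le_card_of_injOn (fun y => y / b ^ (M - t))
  · intro y hy
    simp only [Finset.coe_range, Set.mem_Iio]
    apply Nat.div_lt_of_lt_mul
    rw [← pow_add, Nat.sub_add_cancel ht]
    exact hY y hy
  · intro y hy y' hy' h
    have := hc y hy y' hy'
    simp only at h
    rw [← Nat.div_add_mod y (b ^ (M - t)), ← Nat.div_add_mod y' (b ^ (M - t)), h, this]

lemma exists_t (b m w : ℕ) (hb : b.Prime) (hw : w < m) (Y : Finset ℕ)
    (hY : ∀ y ∈ Y, y < b ^ (m - w) ∧ Nat.Coprime y b) (c : ℤ) :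
    ∃ t : ℕ, ∀ k : ℤ, (Y.filter (fun y : ℕ => ((b ^ m : ℕ) : ℤ) ∣
      k * ((b : ℤ) ^ w * y) + c)).card ≤ if ((b ^ t : ℕ) : ℤ) ∣ k then b ^ t else 0 := by
  have hbZ : Prime (b : ℤ) := Nat.prime_iff_prime_int.mp hb
  have hb0 : (b : ℤ) ≠ 0 := hbZ.ne_zero
  obtain ⟨M, rfl⟩ : ∃ M, m = w + M := ⟨m - w, by omega⟩
  have hM : w + M - w = M := by omega
  rw [hM] at hY
  by_cases hc : (b : ℤ) ^ w ∣ c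
  swap
  · refine ⟨0, fun k => ?_⟩
    rw [Finset.filter_false_of_mem]
    · simp
    · intro y _ hdiv
      apply hc
      have h1 : (b : ℤ) ^ w ∣ k * ((b : ℤ) ^ w * y) + c :=
        Dvd.dvd.trans (by push_cast; rw [pow_add]; exact dvd_mul_right _ _) hdiv
      exact (dvd_add_right ⟨k * y, by ring⟩).mp h1
  obtain ⟨c', rfl⟩ := hc
  have hcond : ∀ (k : ℤ) (y : ℕ), ((b ^ (w + M) : ℕ) : ℤ) ∣ k * ((b : ℤ) ^ w * y) + (b : ℤ) ^ w * c'
      ↔ (b : ℤ) ^ M ∣ k * y + c' := by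
    intro k y
    push_cast
    rw [pow_add, show k * ((b : ℤ) ^ w * y) + (b : ℤ) ^ w * c' = (b : ℤ) ^ w * (k * y + c') by ring]
    exact mul_dvd_mul_iff_left (pow_ne_zero _ hb0)
  simp only [hcond]
  have hcop : ∀ y ∈ Y, ∀ t : ℕ, IsCoprime ((b : ℤ) ^ t) (y : ℤ) := fun y hy t =>
    (Nat.isCoprime_iff_coprime.mpr (hY y hy).2).symm.pow_left
  obtain ⟨t, ht, c'', rfl, hcc⟩ : ∃ t ≤ M, ∃ c'', c' = (b : ℤ) ^ t * c'' ∧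
      (t < M → ¬ (b : ℤ) ∣ c'') := by
    by_cases hcM : (b : ℤ) ^ M ∣ c'
    · obtain ⟨c'', rfl⟩ := hcM
      exact ⟨M, le_rfl, c'', rfl, fun h => absurd h (lt_irrefl _)⟩
    · have hfin : FiniteMultiplicity (b : ℤ) c' := by
        by_contra hnot
        exact hcM (FiniteMultiplicity.not_iff_forall.mp hnot M)
      obtain ⟨c'', h1, h2⟩ := hfin.exists_eq_pow_mul_and_not_dvd
      refine ⟨_, ?_, c'', h1, fun _ => h2⟩
      by_contra hlt
      push Not at hlt
      exact hcM ((pow_dvd_pow _ hlt.le).trans (pow_multiplicity_dvd _ _))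
  refine ⟨t, fun k => ?_⟩
  by_cases hk : ((b ^ t : ℕ) : ℤ) ∣ k
  · rw [if_pos hk]
    push_cast at hk
    obtain ⟨l, rfl⟩ := hk
    apply count_le b M t ht
    · intro y hy
      exact (hY y (Finset.mem_filter.mp hy).1).1
    · intro y hy y' hy'
      have hred : ∀ y : ℕ, (b : ℤ) ^ M ∣ (b : ℤ) ^ t * l * y + (b : ℤ) ^ t * c'' →
          (b : ℤ) ^ (M - t) ∣ l * y + c'' := by
        intro y h
        have e : (b : ℤ) ^ M = (b : ℤ) ^ t * (b : ℤ) ^ (M - t) := by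
          rw [← pow_add]; congr 1; omega
        rw [e, show (b : ℤ) ^ t * l * y + (b : ℤ) ^ t * c'' = (b : ℤ) ^ t * (l * y + c'') by ring]
          at h
        exact (mul_dvd_mul_iff_left (pow_ne_zero _ hb0)).mp h
      have h1 := hred y (Finset.mem_filter.mp hy).2
      have h2 := hred y' (Finset.mem_filter.mp hy').2
      rcases Nat.lt_or_ge t M with htM | htM
      · have hl : ¬ (b : ℤ) ∣ l := by
          intro hbl
          apply hcc htM
          have : (b : ℤ) ∣ l * y + c'' := (dvd_pow_self _ (by omega)).trans h1
          exact (dvd_add_right (hbl.mul_right _)).mp this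
        have hcl : IsCoprime ((b : ℤ) ^ (M - t)) l :=
          ((Prime.coprime_iff_not_dvd hbZ).mpr hl).pow_left
        have h3 : (b : ℤ) ^ (M - t) ∣ l * ((y' : ℤ) - y) := by
          have e : l * ((y' : ℤ) - y) = (l * y' + c'') - (l * y + c'') := by ring
          rw [e]
          exact dvd_sub h2 h1
        have h4 := hcl.dvd_of_dvd_mul_left h3
        rw [Nat.modEq_iff_dvd]
        push_cast
        exact h4
      · rw [Nat.sub_eq_zero_of_le htM, pow_zero]
        exact Nat.modEq_one
  · rw [if_neg hk, Finset.filter_false_of_mem]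
    · simp
    · intro y hy hdiv
      apply hk
      push_cast
      have h1 : (b : ℤ) ^ t ∣ k * y + (b : ℤ) ^ t * c'' := (pow_dvd_pow _ ht).trans hdiv
      have h2 : (b : ℤ) ^ t ∣ k * y := (dvd_add_left (dvd_mul_right _ _)).mp h1
      exact (hcop y hy t).dvd_of_dvd_mul_right h2

lemma gE_mul_le {β : ℝ} (hβ : 1 < β) (B : ℕ) (hB : 0 < B) (l : ℤ) :
    (B : ℝ≥0∞) * gE β (B * l) ≤ gE β l := by
  unfold gE
  rw [← ENNReal.ofReal_natCast, ← ENNReal.ofReal_mul (by positivity)]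
  apply ENNReal.ofReal_le_ofReal
  have hB1 : (1 : ℝ) ≤ B := by exact_mod_cast hB
  push_cast
  rw [abs_mul, Real.mul_rpow (abs_nonneg _) (abs_nonneg _), ← mul_assoc,
    abs_of_nonneg (by positivity : (0 : ℝ) ≤ B)]
  apply mul_le_of_le_one_left (by positivity)
  calc (B : ℝ) * (B : ℝ) ^ (-β) = (B : ℝ) ^ (1 + -β) := by
        rw [Real.rpow_add (by linarith), Real.rpow_one]
    _ ≤ 1 := Real.rpow_le_one_of_one_le_of_nonpos hB1 (by linarith)

lemma key_lt {β : ℝ} (hβ : 1 < β) (b m w : ℕ) (hb : b.Prime) (hw : w < m) (Y : Finset ℕ)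
    (hY : ∀ y ∈ Y, y < b ^ (m - w) ∧ Nat.Coprime y b) (c : ℤ) :
    ∑' k : ℤ, ∑ y ∈ Y, (if ((b ^ m : ℕ) : ℤ) ∣ k * ((b : ℤ) ^ w * y) + c then gE β k else 0)
      ≤ ∑' k : ℤ, gE β k := by
  obtain ⟨t, ht⟩ := exists_t b m w hb hw Y hY c
  have hB : 0 < b ^ t := pow_pos hb.pos _
  calc _ ≤ ∑' k : ℤ, (if ((b ^ t : ℕ) : ℤ) ∣ k then ((b ^ t : ℕ) : ℝ≥0∞) * gE β k else 0) := by
        refine ENNReal.tsum_le_tsum fun k => ?_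
        rw [← Finset.sum_filter, Finset.sum_const, nsmul_eq_mul]
        have h := ht k
        split_ifs at h ⊢ with hd
        · gcongr
        · rw [Nat.le_zero.mp h]; simp
    _ = ∑' l : ℤ, ((b ^ t : ℕ) : ℝ≥0∞) * gE β (((b ^ t : ℕ) : ℤ) * l) := by
        rw [← Function.Injective.tsum_eq (g := fun l : ℤ => ((b ^ t : ℕ) : ℤ) * l)]
        · simp only [dvd_mul_right, if_true]
        · exact mul_right_injective₀ (by exact_mod_cast hB.ne')
        · intro k hk
          have : ((b ^ t : ℕ) : ℤ) ∣ k := by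
            by_contra hn
            exact hk (if_neg hn)
          obtain ⟨l, rfl⟩ := this
          exact ⟨l, rfl⟩
    _ ≤ _ := ENNReal.tsum_le_tsum fun l => gE_mul_le hβ _ hB l

/-- The reduced search space as a finset. -/
def YF (b m w : ℕ) : Finset ℕ :=
  if w < m then (Finset.range (b ^ (m - w))).filter (fun y => (b ^ (m - w)).Coprime y) else {1}

lemma YF_mem (b m w : ℕ) (hb : b.Prime) (y : ℕ) (hy : y ∈ YF b m w) : y ∈ reducedSearch b m w := by
  unfold YF at hy
  unfold reducedSearch
  split_ifs at hy ⊢ with h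
  · simp only [Finset.mem_filter, Finset.mem_range] at hy
    have h1 : b.Coprime y := (Nat.coprime_pow_left_iff (by omega) _ _).mp hy.2
    refine ⟨?_, hy.1, (h1.pow_left m).symm⟩
    by_contra h0
    have : y = 0 := by omega
    subst this
    have := hb.one_lt
    simp at h1
    omega
  · simpa using hy

lemma YF_card (b m w : ℕ) (hb : b.Prime) : b ^ (m - w) ≤ 2 * (YF b m w).card := by
  unfold YF
  split_ifs with h
  · rw [← Nat.totient_eq_card_coprime, Nat.totient_prime_pow hb (by omega)]
    obtain ⟨M, hM⟩ : ∃ M, m - w = M + 1 := ⟨m - w - 1, by omega⟩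
    rw [hM, pow_succ, Nat.add_sub_cancel]
    have := hb.two_le
    have h2 : b ≤ 2 * (b - 1) := by omega
    calc b ^ M * b ≤ b ^ M * (2 * (b - 1)) := Nat.mul_le_mul_left _ h2
      _ = _ := by ring
  · rw [Nat.sub_eq_zero_of_le (by omega)]; simp

lemma key {β : ℝ} (hβ : 1 < β) (b m w : ℕ) (hb : b.Prime) (c : ℤ) :
    ∑' k : ℤ, ∑ y ∈ YF b m w,
      (if ((b ^ m : ℕ) : ℤ) ∣ k * ((b : ℤ) ^ w * y) + c then gE β k else 0)
      ≤ ENNReal.ofReal (2 * rzeta β) := by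
  rw [← tsum_gE hβ]
  by_cases hw : w < m
  · apply key_lt hβ b m w hb hw
    intro y hy
    simp only [YF, hw, if_true, Finset.mem_filter, Finset.mem_range] at hy
    exact ⟨hy.1, ((Nat.coprime_pow_left_iff (by omega) _ _).mp hy.2).symm⟩
  · refine ENNReal.tsum_le_tsum fun k => ?_
    simp only [YF, hw, if_false, Finset.sum_singleton]
    split_ifs <;> simp

lemma avg_bound {n : ℕ} {β : ℝ} (hβ : 1 < β) (b m : ℕ) (hb : b.Prime) (d : Fin (n + 1)) (w : ℕ)
    (u : Finset (Fin (n + 1))) (hd : d ∈ u) (v : ℕ → Fin (n + 1) → ℤ) (ξ : Fin n → ℤ)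
    (hvd : ∀ y, v y d = (b : ℤ) ^ w * y) (hvj : ∀ y j, v y (d.succAbove j) = ξ j) :
    ∑ y ∈ YF b m w, EE (b ^ m) u β (v y) ≤ ENNReal.ofReal (2 * rzeta β) ^ u.card := by
  have hprod : ∏ j, (∑' k, fE u β j k) = ENNReal.ofReal (2 * rzeta β) ^ u.card := by
    simp only [tsum_fE u hβ]
    rw [Finset.prod_ite_mem, Finset.univ_inter, Finset.prod_const]
  rw [← hprod, Fin.prod_univ_succAbove _ d, ← tsum_pi_prod, ← ENNReal.tsum_mul_left, tsum_fE u hβ,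
    if_pos hd]
  unfold EE
  rw [← Summable.tsum_finsetSum (fun _ _ => ENNReal.summable),
    ← (Fin.insertNthEquiv (fun _ : Fin (n+1) => ℤ) d).tsum_eq, ENNReal.tsum_prod',
    ENNReal.tsum_comm]
  refine ENNReal.tsum_le_tsum fun h => ?_
  have := key hβ b m w hb (∑ j, h j * ξ j)
  refine le_trans (le_of_eq ?_) (mul_le_mul_left this _)
  rw [← ENNReal.tsum_mul_right]
  congr 1
  ext k
  rw [Finset.sum_mul]
  refine Finset.sum_congr rfl fun y _ => ?_
  simp only [Fin.insertNthEquiv_apply, Fin.sum_univ_succAbove _ d, Fin.prod_univ_succAbove _ d,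
    Fin.insertNth_apply_same, Fin.insertNth_apply_succAbove, hvd, hvj]
  split_ifs
  · simp [fE, hd]
  · simp

noncomputable def TH {s : ℕ} (N : ℕ) (α : ℝ) (γ : Finset (Fin s) → ℝ) (d : Fin s)
    (ξ : Fin s → ℤ) : ℝ≥0∞ :=
  ∑ u ∈ Finset.univ.powerset.filter (fun u => d ∈ u), ENNReal.ofReal (γ u) * EE N u α ξ

lemma EE_congr {s : ℕ} (N : ℕ) (u : Finset (Fin s)) (α : ℝ) (ξ ξ' : Fin s → ℤ)
    (h : ∀ j ∈ u, ξ j = ξ' j) : EE N u α ξ = EE N u α ξ' := by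
  unfold EE
  congr 1
  ext x
  by_cases hx : ∀ j, j ∉ u → x j = 0
  · have : ∑ j, x j * ξ j = ∑ j, x j * ξ' j := by
      refine Finset.sum_congr rfl fun j _ => ?_
      by_cases hj : j ∈ u
      · rw [h j hj]
      · simp [hx j hj]
    rw [this]
  · have : ∏ j, fE u α j (x j) = 0 := by
      push Not at hx
      obtain ⟨j, hj, hj0⟩ := hx
      apply Finset.prod_eq_zero (Finset.mem_univ j)
      simp [fE, hj, hj0]
    simp [this]

lemma errE_split {s : ℕ} (N : ℕ) (α : ℝ) (γ : Finset (Fin s) → ℝ) (d : Fin s) (ξ : Fin s → ℤ) :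
    errE N α γ ξ = TH N α γ d ξ + ∑ u ∈ (Finset.univ.powerset.filter (fun u => u ≠ ∅)).filter
      (fun u => ¬ d ∈ u), ENNReal.ofReal (γ u) * EE N u α ξ := by
  unfold errE TH
  rw [← Finset.sum_filter_add_sum_filter_not _ (fun u => d ∈ u)]
  congr 2
  ext u
  simp only [Finset.mem_filter, Finset.mem_powerset, Finset.subset_univ, true_and, and_iff_right_iff_imp]
  rintro h rfl
  simp at h

lemma TH_le {s : ℕ} (N : ℕ) {α : ℝ} (hα : 1 < α) (γ : Finset (Fin s) → ℝ) (hγ : ∀ u, 0 < γ u)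
    (d : Fin s) (ξ ξ' : Fin s → ℤ) (hξ : ∀ j, j ≠ d → ξ j = ξ' j)
    (h : korobovErrSq N s α γ ξ ≤ korobovErrSq N s α γ ξ') : TH N α γ d ξ ≤ TH N α γ d ξ' := by
  rw [korobov_eq N hα γ hγ, korobov_eq N hα γ hγ,
    ENNReal.toReal_le_toReal (errE_ne_top N hα γ ξ) (errE_ne_top N hα γ ξ'),
    errE_split N α γ d ξ, errE_split N α γ d ξ'] at h
  have hR : ∑ u ∈ (Finset.univ.powerset.filter (fun u => u ≠ ∅)).filter
      (fun u => ¬ d ∈ u), ENNReal.ofReal (γ u) * EE N u α ξ =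
      ∑ u ∈ (Finset.univ.powerset.filter (fun u => u ≠ ∅)).filter
      (fun u => ¬ d ∈ u), ENNReal.ofReal (γ u) * EE N u α ξ' := by
    refine Finset.sum_congr rfl fun u hu => ?_
    rw [EE_congr N u α ξ ξ']
    intro j hj
    apply hξ
    rintro rfl
    exact (Finset.mem_filter.mp hu).2 hj
  rw [hR] at h
  refine (ENNReal.add_le_add_iff_right ?_).mp h
  exact ENNReal.sum_ne_top.mpr fun u _ =>
    ENNReal.mul_ne_top ENNReal.ofReal_ne_top (EE_ne_top N u hα _)

lemma TH_bound {n : ℕ} (b m : ℕ) (hb : b.Prime) {α lam : ℝ} (h0 : 0 < lam) (h1 : lam ≤ 1)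
    (hαl : 1 < α * lam) (γ : Finset (Fin (n + 1)) → ℝ) (hγ : ∀ u, 0 < γ u) (d : Fin (n + 1))
    (w : ℕ) (v : ℕ → Fin (n + 1) → ℤ) (ξ : Fin n → ℤ)
    (hvd : ∀ y, v y d = (b : ℤ) ^ w * y) (hvj : ∀ y j, v y (d.succAbove j) = ξ j) (T : ℝ≥0∞)
    (hT : ∀ y ∈ YF b m w, T ≤ TH (b ^ m) α γ d (v y)) :
    T ^ lam ≤ ENNReal.ofReal (∑ u ∈ Finset.univ.powerset.filter (fun u => d ∈ u),
          (γ u) ^ lam * (2 * (2 * rzeta (α * lam)) ^ u.card) / (b : ℝ) ^ (m - w)) := by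
  have hz : 0 ≤ rzeta (α * lam) := tsum_nonneg (fun n => by positivity)
  have hbpos : (0 : ℝ) < (b : ℝ) ^ (m - w) := pow_pos (by exact_mod_cast hb.pos) _
  set S : ℝ := ∑ u ∈ Finset.univ.powerset.filter (fun u => d ∈ u),
          (γ u) ^ lam * (2 * rzeta (α * lam)) ^ u.card with hS
  have hS0 : 0 ≤ S := Finset.sum_nonneg fun u _ => by
    have := hγ u
    positivity
  have hmain : ((YF b m w).card : ℝ≥0∞) * T ^ lam ≤ ENNReal.ofReal S := by
    calc ((YF b m w).card : ℝ≥0∞) * T ^ lam = ∑ y ∈ YF b m w, T ^ lam := by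
          rw [Finset.sum_const, nsmul_eq_mul]
      _ ≤ ∑ y ∈ YF b m w, ∑ u ∈ Finset.univ.powerset.filter (fun u => d ∈ u),
            ENNReal.ofReal (γ u ^ lam) * EE (b ^ m) u (α * lam) (v y) := by
          refine Finset.sum_le_sum fun y hy => ?_
          refine (ENNReal.rpow_le_rpow (hT y hy) h0.le).trans ?_
          refine (rpow_finsum_le _ _ h0 h1).trans ?_
          refine Finset.sum_le_sum fun u _ => ?_
          rw [ENNReal.mul_rpow_of_nonneg _ _ h0.le, ENNReal.ofReal_rpow_of_nonneg (hγ u).le h0.le]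
          gcongr
          exact EE_rpow_le _ _ _ _ h0 h1
      _ = ∑ u ∈ Finset.univ.powerset.filter (fun u => d ∈ u),
            ENNReal.ofReal (γ u ^ lam) * ∑ y ∈ YF b m w, EE (b ^ m) u (α * lam) (v y) := by
          rw [Finset.sum_comm]
          simp only [Finset.mul_sum]
      _ ≤ ∑ u ∈ Finset.univ.powerset.filter (fun u => d ∈ u),
            ENNReal.ofReal (γ u ^ lam) * ENNReal.ofReal (2 * rzeta (α * lam)) ^ u.card := by
          refine Finset.sum_le_sum fun u hu => ?_
          gcongr
          exact avg_bound hαl b m hb d w u (Finset.mem_filter.mp hu).2 v ξ hvd hvj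
      _ = ENNReal.ofReal S := by
          rw [hS, ENNReal.ofReal_sum_of_nonneg]
          · refine Finset.sum_congr rfl fun u _ => ?_
            have := hγ u
            rw [← ENNReal.ofReal_pow (by positivity), ← ENNReal.ofReal_mul (by positivity)]
          · intro u _
            have := hγ u
            positivity
  have hEq : ∑ u ∈ Finset.univ.powerset.filter (fun u => d ∈ u),
          (γ u) ^ lam * (2 * (2 * rzeta (α * lam)) ^ u.card) / (b : ℝ) ^ (m - w)
        = 2 * S / (b : ℝ) ^ (m - w) := by
    rw [hS, Finset.mul_sum, Finset.sum_div]
    refine Finset.sum_congr rfl fun u _ => ?_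
    ring
  have hcard : ((b ^ (m - w) : ℕ) : ℝ≥0∞) ≤ 2 * ((YF b m w).card : ℝ≥0∞) := by
    exact_mod_cast YF_card b m w hb
  rw [hEq, ENNReal.ofReal_div_of_pos hbpos, ENNReal.le_div_iff_mul_le
    (Or.inl (ENNReal.ofReal_pos.mpr hbpos).ne') (Or.inl ENNReal.ofReal_ne_top), mul_comm]
  calc ENNReal.ofReal ((b : ℝ) ^ (m - w)) * T ^ lam = ((b ^ (m - w) : ℕ) : ℝ≥0∞) * T ^ lam := by
        rw [← ENNReal.ofReal_natCast]; push_cast; rfl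
    _ ≤ 2 * ((YF b m w).card : ℝ≥0∞) * T ^ lam := by gcongr
    _ = 2 * (((YF b m w).card : ℝ≥0∞) * T ^ lam) := by rw [mul_assoc]
    _ ≤ 2 * ENNReal.ofReal S := by gcongr
    _ = ENNReal.ofReal (2 * S) := by
        rw [ENNReal.ofReal_mul (by norm_num)]; norm_num

lemma errE_le_sum {s : ℕ} (N : ℕ) (α : ℝ) (γ : Finset (Fin s) → ℝ) (ξ : Fin s → ℤ)
    (V : Fin s → Fin s → ℤ) (hV : ∀ d j, j ≤ d → V d j = ξ j) :
    errE N α γ ξ ≤ ∑ d, TH N α γ d (V d) := by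
  unfold errE TH
  simp only [Finset.sum_filter]
  rw [Finset.sum_comm]
  refine Finset.sum_le_sum fun u _ => ?_
  split_ifs with hu
  · have hne := Finset.nonempty_iff_ne_empty.mpr hu
    refine le_trans (le_of_eq ?_) (Finset.single_le_sum
      (f := fun d => if d ∈ u then ENNReal.ofReal (γ u) * EE N u α (V d) else 0)
      (fun _ _ => zero_le) (Finset.mem_univ (u.max' hne)))
    simp only [Finset.max'_mem, if_true]
    rw [EE_congr N u α ξ (V (u.max' hne))]
    intro j hj
    rw [hV _ _ (u.le_max' j hj)]
  · exact zero_le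

theorem reduced_SCS_error_bound (b m s : ℕ) (hb : Nat.Prime b) (hm : 0 < m) (hs : 0 < s)
    (N : ℕ) (hN : N = b ^ m) (α : ℝ) (hα : 1 < α)
    (γ : Finset (Fin s) → ℝ) (hγ : ∀ u, 0 < γ u)
    (w : Fin s → ℕ) (hw : Monotone w)
    (z0 : Fin s → ℤ) (z : Fin s → ℕ)
    -- the vector considered in step `d` of the algorithm, with candidate `y` in place `d`:
    (v : Fin s → ℕ → (Fin s → ℤ))
    (hv : ∀ d y j, v d y j =
      if j < d then ((b : ℤ) ^ (w j) * z j)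
      else if j = d then ((b : ℤ) ^ (w d) * y) else z0 j)
    -- each component is chosen from the reduced search space, minimizing the error:
    (halg : ∀ d : Fin s, z d ∈ reducedSearch b m (w d) ∧
      ∀ y ∈ reducedSearch b m (w d),
        korobovErrSq N s α γ (v d (z d)) ≤ korobovErrSq N s α γ (v d y))
    (lam : ℝ) (hlam1 : 1 / α < lam) (hlam2 : lam ≤ 1) :
    korobovErrSq N s α γ (fun j => (b : ℤ) ^ (w j) * z j) ≤
      (∑ d : Fin s, ∑ u ∈ Finset.univ.powerset.filter (fun u => d ∈ u),
          (γ u) ^ lam * (2 * (2 * rzeta (α * lam)) ^ u.card) / (b : ℝ) ^ (m - w d))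
        ^ (1 / lam) := by 
  subst hN
  have hα0 : 0 < α := by linarith
  have h0 : 0 < lam := lt_trans (by positivity) hlam1
  have hαl : 1 < α * lam := by
    rw [div_lt_iff₀ hα0] at hlam1
    linarith
  obtain ⟨n, rfl⟩ : ∃ n, s = n + 1 := ⟨s - 1, by omega⟩
  have hz : 0 ≤ rzeta (α * lam) := tsum_nonneg (fun n => by positivity)
  have hB0 : ∀ d : Fin (n + 1), 0 ≤ ∑ u ∈ Finset.univ.powerset.filter (fun u => d ∈ u),
      (γ u) ^ lam * (2 * (2 * rzeta (α * lam)) ^ u.card) / (b : ℝ) ^ (m - w d) := fun d =>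
    Finset.sum_nonneg fun u _ => by
      have := hγ u
      positivity
  have hstep : ∀ d : Fin (n + 1), TH (b ^ m) α γ d (v d (z d)) ^ lam ≤
      ENNReal.ofReal (∑ u ∈ Finset.univ.powerset.filter (fun u => d ∈ u),
        (γ u) ^ lam * (2 * (2 * rzeta (α * lam)) ^ u.card) / (b : ℝ) ^ (m - w d)) := by
    intro d
    have hne : ∀ y y' j, j ≠ d → v d y j = v d y' j := by
      intro y y' j hj
      rw [hv, hv, if_neg hj, if_neg hj]
    refine TH_bound b m hb h0 hlam2 hαl γ hγ d (w d) (v d) (fun j => v d 0 (d.succAbove j)) ?_ ?_ _ ?_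
    · intro y
      rw [hv, if_neg (lt_irrefl _), if_pos rfl]
    · intro y j
      exact hne _ _ _ (Fin.succAbove_ne d j)
    · intro y hy
      exact TH_le _ hα γ hγ d _ _ (fun j hj => hne _ _ j hj) ((halg d).2 y (YF_mem b m _ hb y hy))
  have hsum := errE_le_sum (b ^ m) α γ (fun j => (b : ℤ) ^ (w j) * z j) (fun d => v d (z d)) (by
    intro d j hj
    rw [hv]
    rcases hj.lt_or_eq with h | h
    · rw [if_pos h]
    · subst h
      rw [if_neg (lt_irrefl _), if_pos rfl])
  have hfin : errE (b ^ m) α γ (fun j => (b : ℤ) ^ (w j) * z j) ^ lam ≤ ENNReal.ofReal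
      (∑ d : Fin (n + 1), ∑ u ∈ Finset.univ.powerset.filter (fun u => d ∈ u),
        (γ u) ^ lam * (2 * (2 * rzeta (α * lam)) ^ u.card) / (b : ℝ) ^ (m - w d)) := by
    rw [ENNReal.ofReal_sum_of_nonneg (fun d _ => hB0 d)]
    exact (ENNReal.rpow_le_rpow hsum h0.le).trans ((rpow_finsum_le _ _ h0 hlam2).trans
      (Finset.sum_le_sum fun d _ => hstep d))
  have hT0 := Finset.sum_nonneg (s := Finset.univ) fun d _ => hB0 d
  rw [korobov_eq _ hα γ hγ]
  apply ENNReal.toReal_le_of_le_ofReal (by positivity)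
  rw [← ENNReal.ofReal_rpow_of_nonneg hT0 (by positivity), one_div, ENNReal.le_rpow_inv_iff h0]
  exact hfin
end

section
/- Under the assumptions of the reduced SCS error bound for the Korobov space, for all δ ∈ (0, (α−1)/2], the worst-case error of the constructed vector z satisfies e_{N,s}(z) ≤ C · N^{−α/2+δ}, where C = ( 2 Σ_{d=1}^s Σ_{u⊆[s], d∈u} γ_u^{1/(α−2δ)} (2ζ(α/(α−2δ)))^{|u|} b^{w_d} )^{α/2−δ}. -/
open scoped ENNReal

namespace SCS

lemma rpow_tsum_le {ι : Type*} (f : ι → ℝ≥0∞) {p : ℝ} (hp : 0 < p) (hp1 : p ≤ 1) :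
    (∑' i, f i) ^ p ≤ ∑' i, f i ^ p := by
  have h := (ENNReal.orderIsoRpow p hp).map_iSup (fun s : Finset ι => ∑ a ∈ s, f a)
  simp only [ENNReal.orderIsoRpow_apply] at h
  rw [ENNReal.tsum_eq_iSup_sum, h]
  refine iSup_le fun s => le_trans ?_ (ENNReal.sum_le_tsum s)
  induction s using Finset.cons_induction with
  | empty => simp [hp]
  | cons a s ha ih =>
    rw [Finset.sum_cons, Finset.sum_cons]
    exact (ENNReal.rpow_add_le_add_rpow _ _ hp.le hp1).trans (by gcongr)

/-- Summand. -/
noncomputable def rho (β : ℝ) (k : ℤ) : ℝ≥0∞ :=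
  if k = 0 then 0 else ENNReal.ofReal (|(k : ℝ)| ^ (-β))

noncomputable def F {s : ℕ} (u : Finset (Fin s)) (β : ℝ) (j : Fin s) (k : ℤ) : ℝ≥0∞ :=
  if j ∈ u then rho β k else if k = 0 then 1 else 0

noncomputable def Z (β : ℝ) : ℝ≥0∞ := ∑' k : ℤ, rho β k

open Classical in
noncomputable def T {s : ℕ} (N : ℕ) (u : Finset (Fin s)) (β : ℝ) (ξ : Fin s → ℤ) : ℝ≥0∞ :=
  ∑' h : Fin s → ℤ, if (N : ℤ) ∣ ∑ j ∈ u, h j * ξ j then ∏ j, F u β j (h j) else 0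

noncomputable def E {s : ℕ} (N : ℕ) (α : ℝ) (γ : Finset (Fin s) → ℝ) (ξ : Fin s → ℤ) : ℝ≥0∞ :=
  ∑ u ∈ Finset.univ.powerset.filter (fun u => u ≠ ∅), ENNReal.ofReal (γ u) * T N u α ξ

lemma rho_ne_top (β : ℝ) (k : ℤ) : rho β k ≠ ⊤ := by
  unfold rho; split_ifs <;> simp

lemma F_ne_top {s : ℕ} (u : Finset (Fin s)) (β : ℝ) (j : Fin s) (k : ℤ) : F u β j k ≠ ⊤ := by
  unfold F; split_ifs <;> simp [rho_ne_top]

lemma rho_rpow {β p : ℝ} (hp : 0 < p) (k : ℤ) : rho β k ^ p = rho (β * p) k := by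
  unfold rho
  split_ifs with h
  · simp [hp]
  · rw [ENNReal.ofReal_rpow_of_nonneg (by positivity) hp.le, ← Real.rpow_mul (abs_nonneg _), neg_mul]

lemma F_rpow {s : ℕ} (u : Finset (Fin s)) {β p : ℝ} (hp : 0 < p) (j : Fin s) (k : ℤ) :
    F u β j k ^ p = F u (β * p) j k := by
  unfold F
  split_ifs with h
  · exact rho_rpow hp k
  · simp
  · simp [hp]

lemma T_rpow_le {s : ℕ} (N : ℕ) (u : Finset (Fin s)) {β p : ℝ} (hp : 0 < p) (hp1 : p ≤ 1)
    (ξ : Fin s → ℤ) : T N u β ξ ^ p ≤ T N u (β * p) ξ := by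
  unfold T
  refine (rpow_tsum_le _ hp hp1).trans (ENNReal.tsum_le_tsum fun h => ?_)
  split_ifs
  · rw [← ENNReal.prod_rpow_of_nonneg hp.le]
    simp only [F_rpow u hp]; rfl
  · simp [hp]

lemma tsum_pi_prod : ∀ {n : ℕ} (f : Fin n → ℤ → ℝ≥0∞),
    ∑' h : Fin n → ℤ, ∏ j, f j (h j) = ∏ j, ∑' k, f j k
  | 0, f => by simp
  | n + 1, f => by
    rw [← (Fin.consEquiv (fun _ => ℤ)).tsum_eq, Fin.prod_univ_succ,
      ← tsum_pi_prod (fun j => f j.succ), ENNReal.tsum_prod', ← ENNReal.tsum_mul_right]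
    refine tsum_congr fun k => ?_
    rw [← ENNReal.tsum_mul_left]
    refine tsum_congr fun h => ?_
    simp [Fin.consEquiv, Fin.prod_univ_succ]

lemma tsum_F {s : ℕ} (u : Finset (Fin s)) (β : ℝ) (j : Fin s) :
    ∑' k, F u β j k = if j ∈ u then Z β else 1 := by
  unfold F
  split_ifs with h
  · rfl
  · simp

lemma prod_tsum_F {s : ℕ} (u : Finset (Fin s)) (β : ℝ) :
    ∏ j, ∑' k, F u β j k = Z β ^ u.card := by
  simp only [tsum_F]
  rw [Finset.prod_ite]
  simp

lemma T_le {s : ℕ} (N : ℕ) (u : Finset (Fin s)) (β : ℝ) (ξ : Fin s → ℤ) :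
    T N u β ξ ≤ Z β ^ u.card := by
  rw [← prod_tsum_F, ← tsum_pi_prod]
  refine ENNReal.tsum_le_tsum fun h => ?_
  split_ifs <;> simp

lemma T_congr {s : ℕ} (N : ℕ) (u : Finset (Fin s)) (β : ℝ) {ξ η : Fin s → ℤ}
    (h : ∀ j ∈ u, ξ j = η j) : T N u β ξ = T N u β η := by
  unfold T
  refine tsum_congr fun k => ?_
  rw [Finset.sum_congr rfl (fun j hj => by rw [h j hj])]

lemma prod_F_eq {s : ℕ} (u : Finset (Fin s)) (β : ℝ) (h : Fin s → ℤ) :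
    ∏ j, F u β j (h j) = if (∀ j, j ∈ u ↔ h j ≠ 0) then
      ENNReal.ofReal (∏ j ∈ u, |((h j : ℤ) : ℝ)| ^ (-β)) else 0 := by
  split_ifs with H
  · rw [ENNReal.ofReal_prod_of_nonneg (fun _ _ => by positivity),
      ← Finset.prod_subset (Finset.subset_univ u)]
    · refine Finset.prod_congr rfl fun j hj => ?_
      simp [F, hj, rho, (H j).1 hj]
    · intro j _ hj
      have : h j = 0 := by by_contra h0; exact hj ((H j).2 h0)
      simp [F, hj, this]
  · push Not at H
    obtain ⟨j, hj⟩ := H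
    refine Finset.prod_eq_zero (Finset.mem_univ j) ?_
    rcases hj with ⟨h1, h2⟩ | ⟨h1, h2⟩
    · simp [F, h1, h2, rho]
    · simp [F, h1, h2]

lemma T_toReal {s : ℕ} (N : ℕ) (u : Finset (Fin s)) (β : ℝ) (ξ : Fin s → ℤ) :
    (∑' h : {h : Fin s → ℤ //
        (∀ j, j ∈ u ↔ h j ≠ 0) ∧ ((N : ℤ) ∣ ∑ j ∈ u, h j * ξ j)},
      ∏ j ∈ u, |((h.1 j : ℤ) : ℝ)| ^ (-β)) = (T N u β ξ).toReal := by
  classical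
  unfold T
  rw [ENNReal.tsum_toReal_eq]
  · rw [← tsum_subtype_eq_of_support_subset (s := {h : Fin s → ℤ |
        (∀ j, j ∈ u ↔ h j ≠ 0) ∧ ((N : ℤ) ∣ ∑ j ∈ u, h j * ξ j)})]
    · refine tsum_congr fun ⟨h, h1, h2⟩ => ?_
      rw [if_pos h2, prod_F_eq, if_pos h1, ENNReal.toReal_ofReal]
      exact Finset.prod_nonneg fun _ _ => by positivity
    · intro h hh
      rw [Function.mem_support] at hh
      rw [prod_F_eq] at hh
      by_contra hc
      apply hh
      simp only [Set.mem_ofPred_eq, not_and_or] at hc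
      rcases hc with hc | hc
      · rw [if_neg hc]; simp
      · rw [if_neg hc]; simp
  · intro h
    split_ifs
    · exact ENNReal.prod_ne_top fun j _ => F_ne_top _ _ _ _
    · simp

lemma Z_eq {β : ℝ} (hβ : 1 < β) : Z β = ENNReal.ofReal (2 * rzeta β) := by
  have h1 : ∑' n : ℕ, rho β ((n : ℤ) + 1) = ENNReal.ofReal (rzeta β) := by
    unfold rzeta
    rw [ENNReal.ofReal_tsum_of_nonneg]
    · refine tsum_congr fun n => ?_
      have : (n : ℤ) + 1 ≠ 0 := by positivity
      rw [rho, if_neg this]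
      push_cast
      rw [abs_of_pos (by positivity)]
    · intro n; positivity
    · have := (summable_nat_add_iff 1).2 (Real.summable_nat_rpow.2 (show -β < -1 by linarith))
      simpa using this
  have h2 : ∀ k, rho β (-k) = rho β k := by intro k; simp [rho]
  have hs : rho β 0 = 0 := by simp [rho]
  rw [Z, tsum_of_add_one_of_neg_add_one ENNReal.summable ENNReal.summable]
  simp only [h2, hs, h1]
  rw [add_zero, ← ENNReal.ofReal_add, two_mul]
  all_goals exact tsum_nonneg fun n => by positivity

lemma rzeta_nonneg (β : ℝ) : 0 ≤ rzeta β := tsum_nonneg fun n => by positivity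

lemma tsum_dvd_le {β : ℝ} (hβ : 1 ≤ β) (g : ℕ) (hg : 0 < g) :
    ∑' k : ℤ, rho β k * (if (g : ℤ) ∣ k then (g : ℝ≥0∞) else 0) ≤ Z β := by
  have hinj : Function.Injective (fun k : ℤ => (g : ℤ) * k) :=
    mul_right_injective₀ (by positivity)
  rw [← hinj.tsum_eq]
  · refine ENNReal.tsum_le_tsum fun k => ?_
    rw [if_pos (dvd_mul_right _ _)]
    unfold rho
    by_cases hk : k = 0
    · simp [hk]
    · rw [if_neg hk, if_neg (by positivity), ← ENNReal.ofReal_natCast g,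
        ← ENNReal.ofReal_mul (by positivity)]
      apply ENNReal.ofReal_le_ofReal
      push_cast
      rw [abs_mul, Real.mul_rpow (abs_nonneg _) (abs_nonneg _), Nat.abs_cast]
      have h1 : (g : ℝ) ^ (-β) * g ≤ 1 := by
        have hg' : (0 : ℝ) < g := by positivity
        rw [← Real.rpow_add_one hg'.ne']
        exact Real.rpow_le_one_of_one_le_of_nonpos (by exact_mod_cast hg) (by linarith)
      calc _ = |(k : ℝ)| ^ (-β) * ((g : ℝ) ^ (-β) * g) := by ring
        _ ≤ |(k : ℝ)| ^ (-β) * 1 := by gcongr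
        _ = _ := mul_one _
  · intro k hk
    rw [Function.mem_support] at hk
    by_cases hd : (g : ℤ) ∣ k
    · obtain ⟨c, rfl⟩ := hd; exact ⟨c, rfl⟩
    · simp [hd] at hk

lemma gcd_of_dvd {a M y : ℕ} {k c : ℤ} (hy : Nat.Coprime y (a * M))
    (h : ((a * M : ℕ) : ℤ) ∣ k * ((a : ℤ) * y) + c) :
    Int.gcd c (a * M : ℕ) = a * Int.gcd k M := by
  obtain ⟨t, ht⟩ := h
  have hc : c = -(k * a * y) + ((a * M : ℕ) : ℤ) * t := by linarith
  rw [hc, Int.gcd_add_mul_left_left, Int.neg_gcd]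
  have : Int.gcd (k * a * y) (a * M : ℕ) = Int.gcd (k * a) (a * M : ℕ) := by
    simp only [Int.gcd_def, Int.natAbs_mul, Int.natAbs_natCast]
    exact Nat.Coprime.gcd_mul_right_cancel _ hy
  rw [this, mul_comm k, Nat.cast_mul, Int.gcd_mul_left]
  simp

open Classical in
lemma count_le {a M : ℕ} (ha : 0 < a) (hM : 0 < M) (k c : ℤ) :
    ((Finset.range M).filter
      (fun y : ℕ => ((a * M : ℕ) : ℤ) ∣ k * ((a : ℤ) * y) + c)).card ≤ Int.gcd k M := by
  set g := Int.gcd k M with hg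
  have hgpos : 0 < g := Int.gcd_pos_of_ne_zero_right _ (by positivity)
  have hgM : g ∣ M := by exact_mod_cast Int.gcd_dvd_right k M
  obtain ⟨r, hr⟩ := hgM
  have hrpos : 0 < r := Nat.pos_of_ne_zero (by rintro rfl; simp at hr; omega)
  rw [← Finset.card_range g]
  refine Finset.card_le_card_of_injOn (fun y : ℕ => y / r) ?_ ?_
  · intro y hy
    simp only [Finset.coe_filter, Finset.mem_range, Set.mem_ofPred_eq] at hy
    simp only [Finset.coe_range, Set.mem_Iio]
    rw [Nat.div_lt_iff_lt_mul hrpos, ← hr]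
    exact hy.1
  · intro y hy y' hy' hyy
    simp only [Finset.coe_filter, Finset.mem_range, Set.mem_ofPred_eq] at hy hy'
    have h1 := dvd_sub hy.2 hy'.2
    have h2 : ((a : ℤ) * M) ∣ a * (k * ((y : ℤ) - y')) := by
      have e1 : (a : ℤ) * (k * ((y : ℤ) - y')) =
          k * ((a : ℤ) * y) + c - (k * ((a : ℤ) * y') + c) := by ring
      rw [e1, ← Nat.cast_mul]; exact h1
    have h3 : (M : ℤ) ∣ k * ((y : ℤ) - y') := Int.dvd_of_mul_dvd_mul_left (by positivity) h2
    have h4 : (r : ℤ) ∣ ((y : ℤ) - y') := by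
      have h5 := Int.dvd_gcd_mul_iff_dvd_mul.2 h3
      rw [Int.gcd_comm, ← hg, hr, Nat.cast_mul] at h5
      exact Int.dvd_of_mul_dvd_mul_left (by positivity) h5
    have h6 : y' ≡ y [MOD r] := (Nat.modEq_iff_dvd).2 h4
    have h7 := Nat.div_add_mod y r
    have h8 := Nat.div_add_mod y' r
    simp only at hyy
    rw [← h7, ← h8, hyy, h6]

open Classical in
lemma tsum_count_le {a M : ℕ} (ha : 0 < a) (hM : 0 < M) {β : ℝ} (hβ : 1 ≤ β) (Y : Finset ℕ)
    (hY : ∀ y ∈ Y, y < M ∧ Nat.Coprime y (a * M)) (c : ℤ) :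
    ∑' k : ℤ, rho β k * ((Y.filter
      (fun y : ℕ => ((a * M : ℕ) : ℤ) ∣ k * ((a : ℤ) * y) + c)).card : ℝ≥0∞) ≤ Z β := by
  by_cases h0 : ∃ k y, y ∈ Y ∧ ((a * M : ℕ) : ℤ) ∣ k * ((a : ℤ) * y) + c
  · obtain ⟨k0, y0, hy0, hd0⟩ := h0
    have e0 := gcd_of_dvd (hY y0 hy0).2 hd0
    refine le_trans (ENNReal.tsum_le_tsum fun k => ?_)
      (tsum_dvd_le hβ (Int.gcd k0 M) (Int.gcd_pos_of_ne_zero_right _ (by positivity)))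
    by_cases h1 : (Y.filter (fun y : ℕ => ((a * M : ℕ) : ℤ) ∣ k * ((a : ℤ) * y) + c)) = ∅
    · rw [h1]; simp
    · obtain ⟨y, hy⟩ := Finset.nonempty_iff_ne_empty.2 h1
      rw [Finset.mem_filter] at hy
      have e1 := gcd_of_dvd (hY y hy.1).2 hy.2
      have e2 : Int.gcd k M = Int.gcd k0 M := Nat.eq_of_mul_eq_mul_left ha (by rw [← e1, ← e0])
      rw [← e2, if_pos (Int.gcd_dvd_left k M)]
      gcongr
      refine le_trans (Finset.card_le_card ?_) (count_le ha hM k c)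
      exact Finset.filter_subset_filter _ fun y hy => Finset.mem_range.2 (hY y hy).1
  · push Not at h0
    have : ∀ k : ℤ, (Y.filter (fun y : ℕ => ((a * M : ℕ) : ℤ) ∣ k * ((a : ℤ) * y) + c)) = ∅ := by
      intro k
      rw [Finset.filter_eq_empty_iff]
      exact fun y hy => h0 k y hy
    simp only [this]; simp

lemma sum_T_le {s : ℕ} {a M : ℕ} (ha : 0 < a) (hM : 0 < M) {β : ℝ} (hβ : 1 ≤ β) (Y : Finset ℕ)
    (hY : ∀ y ∈ Y, y < M ∧ Nat.Coprime y (a * M)) (u : Finset (Fin s)) (d : Fin s) (hd : d ∈ u)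
    (v : ℕ → Fin s → ℤ) (hv : ∀ y, v y d = (a : ℤ) * y) (hv' : ∀ y y' j, j ≠ d → v y j = v y' j) :
    ∑ y ∈ Y, T (a * M) u β (v y) ≤ Z β ^ u.card := by
  classical
  obtain ⟨n, rfl⟩ : ∃ n, s = n + 1 := ⟨s - 1, by have := d.pos; omega⟩
  have key : ∀ h : Fin (n + 1) → ℤ, ∑ y ∈ Y, (if ((a * M : ℕ) : ℤ) ∣ ∑ j ∈ u, h j * v y j then
      ∏ j, F u β j (h j) else 0) = (∏ j, F u β j (h j)) * ((Y.filter
      (fun y : ℕ => ((a * M : ℕ) : ℤ) ∣ h d * ((a : ℤ) * y) +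
        ∑ j ∈ u.erase d, h j * v 0 j)).card : ℝ≥0∞) := by
    intro h
    rw [← Finset.sum_filter, Finset.sum_const, nsmul_eq_mul, mul_comm]
    congr 4
    ext y
    rw [← Finset.add_sum_erase u _ hd, hv]
    rw [Finset.sum_congr rfl fun j hj => by rw [hv' y 0 j (Finset.ne_of_mem_erase hj)]]
  unfold T
  rw [← Summable.tsum_finsetSum (fun _ _ => ENNReal.summable)]
  simp only [key]
  rw [← (Fin.insertNthEquiv (fun _ => ℤ) d).tsum_eq, ENNReal.tsum_prod', ENNReal.tsum_comm]
  rw [← prod_tsum_F, Fin.prod_univ_succAbove _ d, tsum_F, if_pos hd, ← tsum_pi_prod,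
    ← ENNReal.tsum_mul_left]
  refine ENNReal.tsum_le_tsum fun h => ?_
  have hsum : ∀ k : ℤ, ∑ j ∈ u.erase d, (d.insertNth k h : Fin (n+1) → ℤ) j * v 0 j =
      ∑ j ∈ u.erase d, (d.insertNth 0 h : Fin (n+1) → ℤ) j * v 0 j := by
    intro k
    refine Finset.sum_congr rfl fun j hj => ?_
    obtain ⟨i, rfl⟩ := Fin.exists_succAbove_eq (Finset.ne_of_mem_erase hj)
    simp
  simp only [Fin.insertNthEquiv_apply, Fin.prod_univ_succAbove _ d, Fin.insertNth_apply_same,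
    Fin.insertNth_apply_succAbove, hsum]
  rw [tsum_congr fun k => mul_right_comm (F u β d k) _ _]
  rw [ENNReal.tsum_mul_right]
  gcongr
  refine le_trans (le_of_eq ?_) (tsum_count_le ha hM hβ Y hY
    (∑ j ∈ u.erase d, (d.insertNth 0 h : Fin (n+1) → ℤ) j * v 0 j))
  simp [F, hd]

lemma avg {s b m : ℕ} (hb : b.Prime) (w : ℕ) {β : ℝ} (hβ : 1 ≤ β) (d : Fin s)
    (v : ℕ → Fin s → ℤ) (hv : ∀ y, v y d = (b : ℤ) ^ w * y)
    (hv' : ∀ y y' j, j ≠ d → v y j = v y' j) :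
    ∃ Y : Finset ℕ, Y.Nonempty ∧ (∀ y ∈ Y, y ∈ reducedSearch b m w) ∧
      ∀ u : Finset (Fin s), d ∈ u → ((b ^ m : ℕ) : ℝ≥0∞) * ∑ y ∈ Y, T (b ^ m) u β (v y) ≤
        Y.card * (2 * (b : ℝ≥0∞) ^ w * Z β ^ u.card) := by
  by_cases hw : w < m
  · set M := b ^ (m - w) with hMdef
    have hsplit : b ^ m = b ^ w * M := by rw [hMdef, ← pow_add]; congr 1; omega
    have hMpos : 0 < M := pow_pos hb.pos _
    have hM1 : 1 < M := Nat.one_lt_pow (by omega) hb.one_lt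
    have hapos : 0 < b ^ w := pow_pos hb.pos _
    set Y := (Finset.range M).filter (fun y => M.Coprime y) with hYdef
    have hcard : Y.card = M.totient := rfl
    have hcop : ∀ y, M.Coprime y → Nat.Coprime y (b ^ m) := by
      intro y hy
      have : b.Coprime y := (Nat.coprime_pow_left_iff (by omega) _ _).1 hy
      exact (this.symm).pow_right _
    have hYp : ∀ y ∈ Y, y < M ∧ Nat.Coprime y (b ^ w * M) := by
      intro y hy
      rw [hYdef, Finset.mem_filter, Finset.mem_range] at hy
      exact ⟨hy.1, hsplit ▸ hcop y hy.2⟩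
    have htot : M ≤ 2 * Y.card := by
      rw [hcard, hMdef, Nat.totient_prime_pow hb (by omega)]
      have h2 := hb.two_le
      obtain ⟨r, hr⟩ : ∃ r, m - w = r + 1 := ⟨m - w - 1, by omega⟩
      rw [hr, pow_succ]
      simp only [Nat.add_sub_cancel]
      have : b ≤ 2 * (b - 1) := by omega
      calc b ^ r * b ≤ b ^ r * (2 * (b - 1)) := by gcongr
        _ = _ := by ring
    refine ⟨Y, ⟨1, ?_⟩, ?_, ?_⟩
    · rw [hYdef, Finset.mem_filter, Finset.mem_range]; exact ⟨hM1, by simp⟩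
    · intro y hy
      rw [reducedSearch, if_pos hw]
      have h1 := hYp y hy
      refine ⟨Nat.one_le_iff_ne_zero.2 ?_, h1.1, hsplit ▸ h1.2⟩
      rintro rfl
      have := h1.2
      rw [Nat.coprime_zero_left, ← hsplit] at this
      have h3 := Nat.one_lt_pow (n := m) (by omega) hb.one_lt
      omega
    · intro u hu
      have h1 := sum_T_le hapos hMpos hβ Y hYp u d hu v (by simpa using hv) hv'
      rw [hsplit]
      calc _ ≤ ((b ^ w * M : ℕ) : ℝ≥0∞) * Z β ^ u.card := by gcongr
        _ ≤ ((b ^ w * (2 * Y.card) : ℕ) : ℝ≥0∞) * Z β ^ u.card := by gcongr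
        _ = _ := by push_cast; ring
  · refine ⟨{1}, by simp, ?_, ?_⟩
    · intro y hy; rw [reducedSearch, if_neg hw]; simpa using hy
    · intro u hu
      have h1 : ((b ^ m : ℕ) : ℝ≥0∞) ≤ ((b ^ w : ℕ) : ℝ≥0∞) := by
        exact_mod_cast Nat.pow_le_pow_right hb.pos (by omega)
      have h2 : (1 : ℝ≥0∞) ≤ 2 := by norm_num
      simp only [Finset.sum_singleton, Finset.card_singleton]
      calc _ ≤ ((b ^ w : ℕ) : ℝ≥0∞) * Z β ^ u.card := by gcongr; exact T_le _ _ _ _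
        _ = 1 * ((b : ℝ≥0∞) ^ w * Z β ^ u.card) := by push_cast; ring
        _ ≤ 2 * ((b : ℝ≥0∞) ^ w * Z β ^ u.card) := by gcongr
        _ = _ := by push_cast; ring

lemma rpow_sum_le {ι : Type*} (s : Finset ι) (f : ι → ℝ≥0∞) {p : ℝ} (hp : 0 < p) (hp1 : p ≤ 1) :
    (∑ i ∈ s, f i) ^ p ≤ ∑ i ∈ s, f i ^ p := by
  induction s using Finset.cons_induction with
  | empty => simp [hp]
  | cons a s ha ih =>
    rw [Finset.sum_cons, Finset.sum_cons]
    exact (ENNReal.rpow_add_le_add_rpow _ _ hp.le hp1).trans (by gcongr)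

lemma step {s b m : ℕ} (hb : b.Prime) (w : ℕ) {α p : ℝ} (hp : 0 < p) (hp1 : p ≤ 1)
    (hβ : 1 ≤ α * p) (γ : Finset (Fin s) → ℝ) (d : Fin s) (z : ℕ)
    (v : ℕ → Fin s → ℤ) (hv : ∀ y, v y d = (b : ℤ) ^ w * y)
    (hv' : ∀ y y' j, j ≠ d → v y j = v y' j)
    (hmin : ∀ y ∈ reducedSearch b m w,
      ∑ u ∈ Finset.univ.powerset.filter (fun u => d ∈ u), ENNReal.ofReal (γ u) * T (b ^ m) u α (v z)
      ≤ ∑ u ∈ Finset.univ.powerset.filter (fun u => d ∈ u),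
        ENNReal.ofReal (γ u) * T (b ^ m) u α (v y)) :
    ((b ^ m : ℕ) : ℝ≥0∞) * (∑ u ∈ Finset.univ.powerset.filter (fun u => d ∈ u),
      ENNReal.ofReal (γ u) * T (b ^ m) u α (v z)) ^ p ≤
    ∑ u ∈ Finset.univ.powerset.filter (fun u => d ∈ u),
      ENNReal.ofReal (γ u) ^ p * (2 * (b : ℝ≥0∞) ^ w * Z (α * p) ^ u.card) := by
  obtain ⟨Y, hne, hYs, hYb⟩ := avg (m := m) hb w hβ d v hv hv'
  set P := Finset.univ.powerset.filter (fun u : Finset (Fin s) => d ∈ u) with hP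
  set θ := ∑ u ∈ P, ENNReal.ofReal (γ u) * T (b ^ m) u α (v z) with hθ
  have hc0 : (Y.card : ℝ≥0∞) ≠ 0 := by
    simpa using hne.ne_empty
  rw [← ENNReal.mul_le_mul_iff_right hc0 (ENNReal.natCast_ne_top _)]
  have h1 : ∀ y ∈ Y, θ ^ p ≤ ∑ u ∈ P, ENNReal.ofReal (γ u) ^ p * T (b ^ m) u (α * p) (v y) := by
    intro y hy
    refine (ENNReal.rpow_le_rpow (hmin y (hYs y hy)) hp.le).trans ?_
    refine (rpow_sum_le _ _ hp hp1).trans (Finset.sum_le_sum fun u _ => ?_)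
    rw [ENNReal.mul_rpow_of_nonneg _ _ hp.le]
    gcongr
    exact T_rpow_le _ _ hp hp1 _
  calc (Y.card : ℝ≥0∞) * (((b ^ m : ℕ) : ℝ≥0∞) * θ ^ p)
      = ((b ^ m : ℕ) : ℝ≥0∞) * ∑ y ∈ Y, θ ^ p := by
        rw [Finset.sum_const, nsmul_eq_mul]; ring
    _ ≤ ((b ^ m : ℕ) : ℝ≥0∞) *
        ∑ y ∈ Y, ∑ u ∈ P, ENNReal.ofReal (γ u) ^ p * T (b ^ m) u (α * p) (v y) := by
        gcongr with y hy; exact h1 y hy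
    _ = ∑ u ∈ P, ENNReal.ofReal (γ u) ^ p *
        (((b ^ m : ℕ) : ℝ≥0∞) * ∑ y ∈ Y, T (b ^ m) u (α * p) (v y)) := by
        rw [Finset.sum_comm, Finset.mul_sum]
        refine Finset.sum_congr rfl fun u _ => ?_
        rw [← Finset.mul_sum]; ring
    _ ≤ ∑ u ∈ P, ENNReal.ofReal (γ u) ^ p *
        (Y.card * (2 * (b : ℝ≥0∞) ^ w * Z (α * p) ^ u.card)) := by
        refine Finset.sum_le_sum fun u hu => ?_
        exact mul_le_mul_right (hYb u (Finset.mem_filter.1 hu).2) _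
    _ = _ := by
        rw [Finset.mul_sum]
        refine Finset.sum_congr rfl fun u _ => ?_
        ring

lemma T_ne_top {s : ℕ} (N : ℕ) (u : Finset (Fin s)) {β : ℝ} (hβ : 1 < β) (ξ : Fin s → ℤ) :
    T N u β ξ ≠ ⊤ := by
  refine ne_top_of_le_ne_top ?_ (T_le N u β ξ)
  rw [Z_eq hβ]
  exact ENNReal.pow_ne_top ENNReal.ofReal_ne_top

lemma E_ne_top {s : ℕ} (N : ℕ) {α : ℝ} (hα : 1 < α) (γ : Finset (Fin s) → ℝ) (ξ : Fin s → ℤ) :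
    E N α γ ξ ≠ ⊤ :=
  ENNReal.sum_ne_top.2 fun u _ => ENNReal.mul_ne_top ENNReal.ofReal_ne_top (T_ne_top N u hα ξ)

lemma err_eq {s : ℕ} (N : ℕ) {α : ℝ} (hα : 1 < α) (γ : Finset (Fin s) → ℝ) (hγ : ∀ u, 0 < γ u)
    (ξ : Fin s → ℤ) : korobovErrSq N s α γ ξ = (E N α γ ξ).toReal := by
  unfold korobovErrSq E
  rw [ENNReal.toReal_sum]
  · refine Finset.sum_congr rfl fun u _ => ?_
    rw [T_toReal, ENNReal.toReal_mul, ENNReal.toReal_ofReal (hγ u).le]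
  · exact fun u _ => ENNReal.mul_ne_top ENNReal.ofReal_ne_top (T_ne_top N u hα ξ)

lemma E_split {s : ℕ} (N : ℕ) (α : ℝ) (γ : Finset (Fin s) → ℝ) (ξ : Fin s → ℤ) (d : Fin s) :
    E N α γ ξ = ∑ u ∈ Finset.univ.powerset.filter (fun u => d ∈ u), ENNReal.ofReal (γ u) * T N u α ξ
      + ∑ u ∈ Finset.univ.powerset.filter (fun u => u ≠ ∅ ∧ d ∉ u),
        ENNReal.ofReal (γ u) * T N u α ξ := by
  unfold E
  rw [← Finset.sum_filter_add_sum_filter_not _ (fun u => d ∈ u), Finset.filter_filter,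
    Finset.filter_filter]
  congr 2
  ext u
  simp only [Finset.mem_filter]
  constructor
  · rintro ⟨h1, -, h2⟩; exact ⟨h1, h2⟩
  · rintro ⟨h1, h2⟩; exact ⟨h1, Finset.ne_empty_of_mem h2, h2⟩

lemma E_le {s : ℕ} (N : ℕ) (α : ℝ) (γ : Finset (Fin s) → ℝ) (ξ : Fin s → ℤ)
    (η : Fin s → Fin s → ℤ) (h : ∀ d j, j ≤ d → ξ j = η d j) :
    E N α γ ξ ≤ ∑ d, ∑ u ∈ Finset.univ.powerset.filter (fun u => d ∈ u),
      ENNReal.ofReal (γ u) * T N u α (η d) := by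
  have : ∀ d, ∑ u ∈ Finset.univ.powerset.filter (fun u => d ∈ u),
      ENNReal.ofReal (γ u) * T N u α (η d) = ∑ u ∈ Finset.univ.powerset,
      if d ∈ u then ENNReal.ofReal (γ u) * T N u α (η d) else 0 := fun d => Finset.sum_filter _ _
  simp only [this]
  rw [Finset.sum_comm]
  unfold E
  rw [Finset.sum_filter]
  refine Finset.sum_le_sum fun u _ => ?_
  split_ifs with hu
  · have hne := Finset.nonempty_iff_ne_empty.2 hu
    refine le_trans (le_of_eq ?_) (Finset.single_le_sum (f := fun d =>
      if d ∈ u then ENNReal.ofReal (γ u) * T N u α (η d) else 0) (fun _ _ => zero_le)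
      (Finset.mem_univ (u.max' hne)))
    simp only [Finset.max'_mem, if_true]
    rw [T_congr N u α (fun j hj => h (u.max' hne) j (u.le_max' j hj))]
  · exact zero_le

end SCS

open SCS in
theorem reduced_SCS_convergence_rate (b m s : ℕ) (hb : Nat.Prime b) (hm : 0 < m) (hs : 0 < s)
    (N : ℕ) (hN : N = b ^ m) (α : ℝ) (hα : 1 < α)
    (γ : Finset (Fin s) → ℝ) (hγ : ∀ u, 0 < γ u)
    (w : Fin s → ℕ) (hw : Monotone w)
    (z0 : Fin s → ℤ) (z : Fin s → ℕ)
    -- the vector considered in step `d` of the algorithm, with candidate `y` in place `d`: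
    (v : Fin s → ℕ → (Fin s → ℤ))
    (hv : ∀ d y j, v d y j =
      if j < d then ((b : ℤ) ^ (w j) * z j)
      else if j = d then ((b : ℤ) ^ (w d) * y) else z0 j)
    -- each component is chosen from the reduced search space, minimizing the error:
    (halg : ∀ d : Fin s, z d ∈ reducedSearch b m (w d) ∧
      ∀ y ∈ reducedSearch b m (w d),
        korobovErrSq N s α γ (v d (z d)) ≤ korobovErrSq N s α γ (v d y))
    (δ : ℝ) (hδ0 : 0 < δ) (hδ1 : δ ≤ (α - 1) / 2) :
    Real.sqrt (korobovErrSq N s α γ (fun j => (b : ℤ) ^ (w j) * z j)) ≤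
      (2 * ∑ d : Fin s, ∑ u ∈ Finset.univ.powerset.filter (fun u => d ∈ u),
          (γ u) ^ (1 / (α - 2 * δ)) * (2 * rzeta (α / (α - 2 * δ))) ^ u.card * (b : ℝ) ^ (w d))
        ^ (α / 2 - δ) * (N : ℝ) ^ (-(α / 2) + δ) := by
  subst hN
  set p : ℝ := 1 / (α - 2 * δ) with hpdef
  have hq : 1 ≤ α - 2 * δ := by linarith
  have hp : 0 < p := by positivity
  have hp1 : p ≤ 1 := by rw [hpdef, div_le_one (by linarith)]; exact hq
  have hβe : α / (α - 2 * δ) = α * p := by rw [hpdef]; ring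
  have hβ : 1 < α * p := by rw [← hβe, one_lt_div (by linarith)]; linarith
  have hvd : ∀ d y, v d y d = (b : ℤ) ^ w d * y := by intro d y; rw [hv]; simp
  have hvd' : ∀ d y y' j, j ≠ d → v d y j = v d y' j := by
    intro d y y' j hj; rw [hv, hv]; simp [hj]
  have hstep : ∀ d, _ := fun d => step (m := m) hb (w d) hp hp1 hβ.le γ d (z d) (v d) (hvd d)
    (hvd' d) (by
      intro y hy
      have h1 := (halg d).2 y hy
      rw [err_eq _ hα γ hγ, err_eq _ hα γ hγ,
        ENNReal.toReal_le_toReal (E_ne_top _ hα _ _) (E_ne_top _ hα _ _),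
        E_split _ _ _ _ d, E_split _ _ _ (v d y) d] at h1
      have h2 : ∑ u ∈ Finset.univ.powerset.filter (fun u => u ≠ ∅ ∧ d ∉ u),
          ENNReal.ofReal (γ u) * T (b ^ m) u α (v d (z d)) =
          ∑ u ∈ Finset.univ.powerset.filter (fun u => u ≠ ∅ ∧ d ∉ u),
          ENNReal.ofReal (γ u) * T (b ^ m) u α (v d y) := by
        refine Finset.sum_congr rfl fun u hu => ?_
        rw [T_congr]
        intro j hj
        refine hvd' d _ _ j ?_
        rintro rfl
        exact (Finset.mem_filter.1 hu).2.2 hj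
      rw [h2] at h1
      refine (ENNReal.add_le_add_iff_right ?_).1 h1
      exact ENNReal.sum_ne_top.2 fun u _ =>
        ENNReal.mul_ne_top ENNReal.ofReal_ne_top (T_ne_top _ u hα _))
  have hE := E_le (b ^ m) α γ (fun j => (b : ℤ) ^ (w j) * z j) (fun d => v d (z d)) (by
    intro d j hj
    show _ = v d (z d) j
    rw [hv]
    rcases hj.lt_or_eq with h | h
    · simp [h]
    · subst h; simp)
  set e := E (b ^ m) α γ (fun j => (b : ℤ) ^ (w j) * z j) with he
  set S := ∑ d : Fin s, ∑ u ∈ Finset.univ.powerset.filter (fun u => d ∈ u),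
          (γ u) ^ p * (2 * rzeta (α / (α - 2 * δ))) ^ u.card * (b : ℝ) ^ (w d) with hS
  have hz := rzeta_nonneg (α * p)
  have hS0 : 0 ≤ S := by
    rw [hS, hβe]
    refine Finset.sum_nonneg fun d _ => Finset.sum_nonneg fun u _ => ?_
    have := hγ u
    positivity
  have hmain : ((b ^ m : ℕ) : ENNReal) * e ^ p ≤ ENNReal.ofReal (2 * S) := by
    calc ((b ^ m : ℕ) : ENNReal) * e ^ p ≤ ((b ^ m : ℕ) : ENNReal) * ∑ d,
          (∑ u ∈ Finset.univ.powerset.filter (fun u => d ∈ u),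
            ENNReal.ofReal (γ u) * T (b ^ m) u α (v d (z d))) ^ p := by
          gcongr
          exact (ENNReal.rpow_le_rpow hE hp.le).trans (rpow_sum_le _ _ hp hp1)
      _ ≤ ∑ d, ∑ u ∈ Finset.univ.powerset.filter (fun u => d ∈ u),
          ENNReal.ofReal (γ u) ^ p * (2 * (b : ENNReal) ^ w d * Z (α * p) ^ u.card) := by
          rw [Finset.mul_sum]
          exact Finset.sum_le_sum fun d _ => hstep d
      _ = ENNReal.ofReal (2 * S) := by
          rw [hS, hβe, Finset.mul_sum, ENNReal.ofReal_sum_of_nonneg]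
          · refine Finset.sum_congr rfl fun d _ => ?_
            rw [Finset.mul_sum, ENNReal.ofReal_sum_of_nonneg]
            · refine Finset.sum_congr rfl fun u _ => ?_
              rw [Z_eq hβ, ENNReal.ofReal_rpow_of_pos (hγ u)]
              have := hγ u
              obtain ⟨R, hR⟩ : ∃ R, R = 2 * rzeta (α * p) := ⟨_, rfl⟩
              have hR0 : 0 ≤ R := by rw [hR]; positivity
              rw [← hR, ENNReal.ofReal_mul (by norm_num), ENNReal.ofReal_mul (by positivity),
                ENNReal.ofReal_mul (by positivity), ENNReal.ofReal_pow (by positivity),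
                ENNReal.ofReal_pow (by positivity)]
              simp only [ENNReal.ofReal_natCast, ENNReal.ofReal_ofNat]
              ring
            · intro u _; have := hγ u; positivity
          · intro d _
            refine mul_nonneg (by norm_num) (Finset.sum_nonneg fun u _ => ?_)
            have := hγ u
            positivity
  rw [err_eq _ hα γ hγ, ← he]
  have hr := ENNReal.toReal_mono ENNReal.ofReal_ne_top hmain
  rw [ENNReal.toReal_mul, ENNReal.toReal_ofReal (by positivity), ← ENNReal.toReal_rpow,
    ENNReal.toReal_natCast] at hr
  have hx : 0 ≤ e.toReal := ENNReal.toReal_nonneg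
  set x := e.toReal with hxdef
  have hNpos : (0 : ℝ) < ((b ^ m : ℕ) : ℝ) := by exact_mod_cast pow_pos hb.pos m
  have h1 : x ^ p ≤ 2 * S * (((b ^ m : ℕ) : ℝ))⁻¹ := by
    rw [← div_eq_mul_inv, le_div_iff₀ hNpos, mul_comm]; exact hr
  have h2 : Real.sqrt x = (x ^ p) ^ (α / 2 - δ) := by
    rw [← Real.rpow_mul hx, Real.sqrt_eq_rpow]
    congr 1
    rw [hpdef]
    field_simp
  rw [h2]
  calc (x ^ p) ^ (α / 2 - δ) ≤ (2 * S * (((b ^ m : ℕ) : ℝ))⁻¹) ^ (α / 2 - δ) :=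
        Real.rpow_le_rpow (by positivity) h1 (by linarith)
    _ = _ := by
        rw [Real.mul_rpow (by positivity) (by positivity), Real.inv_rpow hNpos.le,
          ← Real.rpow_neg hNpos.le]
        congr 2
        ring
end

section
/- Let N = b^m with b prime, α > 1, and let (γ_u)_{u⊆[s]} be general positive weights. For any starting vector z^0, the (unreduced) SCS algorithm (i.e., the reduced SCS algorithm with all w_j = 0) constructs z = (z_1,…,z_s) such that for all λ ∈ (1/α, 1], e²_{N,s}(z) ≤ ( Σ_{d=1}^s Σ_{u⊆[s], d∈u} γ_u^λ · 2(2ζ(αλ))^{|u|} / b^m )^{1/λ}. In particular, e_{N,s}(z) = O(N^{−α/2+δ}) for δ arbitrarily close to 0, with implied constant independent of s if sup_{s∈ℕ} 2 Σ_{d=1}^s Σ_{u⊆[s], d∈u} γ_u^{1/(α−2δ)} (2ζ(α/(α−2δ)))^{|u|} < ∞. -/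
/-- The (unreduced) search space for one component of the generating vector:
all integers in `{1,…,b^m−1}` coprime to `N = b^m`. -/
def fullSearch (b m : ℕ) : Set ℕ :=
  {z | 1 ≤ z ∧ z < b ^ m ∧ Nat.gcd z (b ^ m) = 1}

namespace SCSAux
open scoped ENNReal

/-- one-dimensional weight -/
noncomputable def w (x : ℝ) (k : ℤ) : ℝ≥0∞ :=
  if k = 0 then 0 else ENNReal.ofReal (|(k : ℝ)| ^ (-x))

noncomputable def Z (x : ℝ) : ℝ≥0∞ := ∑' k, w x k

lemma tsum_pi_prod {ι : Type} [Fintype ι] (W : ι → ℤ → ℝ≥0∞) :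
    ∑' h : ι → ℤ, ∏ j, W j (h j) = ∏ j, ∑' k, W j k := by
  revert W
  refine Fintype.induction_empty_option (P := fun ι _ => ∀ W : ι → ℤ → ℝ≥0∞,
    ∑' h : ι → ℤ, ∏ j, W j (h j) = ∏ j, ∑' k, W j k) ?_ ?_ ?_ ι
  · intro α β _ e ih W
    let _ := Fintype.ofEquiv β e.symm
    have h1 := ih (fun a => W (e a))
    rw [← (Equiv.arrowCongr e (Equiv.refl ℤ)).tsum_eq]
    rw [← e.prod_comp (fun j => ∑' k, W j k)]
    convert h1 using 2
    funext h
    rw [← e.prod_comp]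
    simp [Equiv.arrowCongr]
  · intro W
    simp
  · intro α _ ih W
    rw [← (Equiv.piOptionEquivProd (β := fun _ => ℤ)).symm.tsum_eq, ENNReal.tsum_prod',
      Fintype.prod_option, ← ih, ← ENNReal.tsum_mul_right]
    congr 1
    funext k
    rw [← ENNReal.tsum_mul_left]
    congr 1
    funext h
    simp [Equiv.piOptionEquivProd, Fintype.prod_option]

lemma rpow_sum_le {ι : Type*} (s : Finset ι) (f : ι → ℝ≥0∞) {p : ℝ} (hp : 0 < p) (hp1 : p ≤ 1) :
    (∑ i ∈ s, f i) ^ p ≤ ∑ i ∈ s, f i ^ p := by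
  classical
  induction s using Finset.induction_on with
  | empty => simp [hp]
  | insert a s ha ih =>
    rw [Finset.sum_insert ha, Finset.sum_insert ha]
    exact (ENNReal.rpow_add_le_add_rpow _ _ hp.le hp1).trans (by gcongr)

lemma rpow_tsum_le {ι : Type*} (f : ι → ℝ≥0∞) {p : ℝ} (hp : 0 < p) (hp1 : p ≤ 1) :
    (∑' i, f i) ^ p ≤ ∑' i, f i ^ p := by
  rw [← ENNReal.le_rpow_inv_iff hp, ENNReal.tsum_eq_iSup_sum]
  refine iSup_le fun s => ?_
  rw [ENNReal.le_rpow_inv_iff hp]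
  exact (rpow_sum_le s f hp hp1).trans (ENNReal.sum_le_tsum s)

lemma ofReal_tsum_le {ι : Type*} (f : ι → ℝ) (hf : ∀ i, 0 ≤ f i) :
    ENNReal.ofReal (∑' i, f i) ≤ ∑' i, ENNReal.ofReal (f i) := by
  by_cases h : Summable f
  · rw [ENNReal.ofReal_tsum_of_nonneg hf h]
  · simp [tsum_eq_zero_of_not_summable h]

lemma rzeta_nonneg (x : ℝ) : 0 ≤ rzeta x := tsum_nonneg fun n => by positivity

lemma Z_eq (x : ℝ) (hx : 1 < x) : Z x = ENNReal.ofReal (2 * rzeta x) := by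
  unfold Z
  have hsum : Summable (fun n : ℕ => ((n : ℝ) + 1) ^ (-x)) := by
    have := (Real.summable_one_div_nat_add_rpow 1 x).2 hx
    refine this.congr fun n => ?_
    rw [abs_of_pos (by positivity), Real.rpow_neg (by positivity), one_div]
  rw [tsum_of_add_one_of_neg_add_one (f := w x) ENNReal.summable ENNReal.summable]
  have h1 : ∀ n : ℕ, w x ((n : ℤ) + 1) = ENNReal.ofReal (((n : ℝ) + 1) ^ (-x)) := by
    intro n
    rw [w, if_neg (by omega)]
    push_cast
    rw [abs_of_pos (by positivity)]
  have h2 : ∀ n : ℕ, w x (-((n : ℤ) + 1)) = ENNReal.ofReal (((n : ℝ) + 1) ^ (-x)) := by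
    intro n
    rw [w, if_neg (by omega)]
    push_cast
    rw [abs_neg, abs_of_pos (by positivity)]
  simp_rw [h1, h2]
  rw [← ENNReal.ofReal_tsum_of_nonneg (fun n => by positivity) hsum]
  have : w x 0 = 0 := by simp [w]
  change ENNReal.ofReal (rzeta x) + w x 0 + ENNReal.ofReal (rzeta x) = _
  rw [this, add_zero, ← ENNReal.ofReal_add (rzeta_nonneg x) (rzeta_nonneg x), two_mul]

lemma card_le (N : ℕ) (hN : 0 < N) (c k : ℤ) (S : Finset ℕ)
    (hS : ∀ y ∈ S, y < N ∧ Nat.Coprime y N) :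
    ((S.filter (fun y : ℕ => (N : ℤ) ∣ k * y + c)).card) ≤
      if ((Int.gcd c N : ℕ) : ℤ) ∣ k then Int.gcd c N else 0 := by
  set G := Int.gcd c N with hG
  have hGN : G ∣ N := by
    have := Int.gcd_dvd_right c N
    exact_mod_cast this
  obtain ⟨M, hM⟩ := hGN
  have hG0 : 0 < G := Nat.pos_of_ne_zero (by rintro h; simp [h] at hM; omega)
  have hM0 : 0 < M := Nat.pos_of_ne_zero (by rintro h; simp [h] at hM; omega)
  have hGc : (G : ℤ) ∣ c := Int.gcd_dvd_left c N
  have key : ∀ y ∈ S.filter (fun y : ℕ => (N : ℤ) ∣ k * y + c), (Int.gcd k N) = G := by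
    intro y hy
    rw [Finset.mem_filter] at hy
    obtain ⟨hyS, q, hq⟩ := hy
    have hc : c = -(k * y) + N * q := by linarith
    have hco := (hS y hyS).2
    rw [hG, hc, Int.gcd_add_mul_left_left, Int.neg_gcd, mul_comm]
    simp only [Int.gcd, Int.natAbs_mul, Int.natAbs_natCast]
    exact (hco.gcd_mul_left_cancel _).symm
  split_ifs with hk
  · calc _ ≤ (Finset.range G).card := by
          refine Finset.card_le_card_of_injOn (fun y => y / M) ?_ ?_
          · intro y hy
            have hy := Finset.mem_filter.1 hy
            have := (hS y hy.1).1
            simp only [Finset.coe_range, Set.mem_Iio]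
            rw [Nat.div_lt_iff_lt_mul hM0, ← hM]; exact this
          · intro y hy y' hy' hyy
            have hgk := key y hy
            have hy := (Finset.mem_filter.1 hy).2
            have hy' := (Finset.mem_filter.1 hy').2
            have hd : (N : ℤ) ∣ k * ((y : ℤ) - y') := by
              have := dvd_sub hy hy'
              ring_nf at this ⊢
              exact this
            obtain ⟨k', hk'⟩ := hk
            have hd2 : (M : ℤ) ∣ k' * ((y : ℤ) - y') := by
              rw [hM, hk'] at hd
              push_cast at hd
              rw [mul_assoc] at hd
              exact (mul_dvd_mul_iff_left (by exact_mod_cast hG0.ne')).1 hd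
            have hcop : Int.gcd M k' = 1 := by
              rw [hk', hM] at hgk
              push_cast at hgk
              rw [Int.gcd_mul_left, Int.natAbs_natCast] at hgk
              rw [Int.gcd_comm]
              exact Nat.eq_of_mul_eq_mul_left hG0 (by simpa using hgk)
            have hd3 : (M : ℤ) ∣ (y : ℤ) - y' :=
              Int.dvd_of_dvd_mul_right_of_gcd_one hd2 hcop
            have hmod : y' % M = y % M := (Nat.modEq_iff_dvd.2 hd3)
            simp only at hyy
            rw [← Nat.div_add_mod y M, ← Nat.div_add_mod y' M, hyy, hmod]
    _ = G := by simp
  · rw [Nat.le_zero, Finset.card_eq_zero, Finset.eq_empty_iff_forall_notMem]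
    intro y hy
    apply hk
    rw [← key y hy]
    exact Int.gcd_dvd_left k N

lemma w_mul_le (x : ℝ) (hx : 1 ≤ x) (G : ℕ) (hG : 0 < G) (k : ℤ) :
    (G : ℝ≥0∞) * w x (G * k) ≤ w x k := by
  unfold w
  by_cases hk : k = 0
  · simp [hk]
  have hG' : (1 : ℝ) ≤ G := by exact_mod_cast hG
  rw [if_neg hk, if_neg (by simp [hk, hG.ne'])]
  rw [← ENNReal.ofReal_natCast G, ← ENNReal.ofReal_mul (by positivity)]
  apply ENNReal.ofReal_le_ofReal
  push_cast
  rw [abs_mul, Real.mul_rpow (by positivity) (by positivity), ← mul_assoc,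
    abs_of_pos (by positivity : (0:ℝ) < G)]
  have : (G : ℝ) * (G : ℝ) ^ (-x) ≤ 1 := by
    nth_rw 1 [← Real.rpow_one (G : ℝ)]
    rw [← Real.rpow_add (by positivity)]
    exact Real.rpow_le_one_of_one_le_of_nonpos hG' (by linarith)
  exact mul_le_of_le_one_left (by positivity) this

lemma inner_le (x : ℝ) (hx : 1 ≤ x) (N : ℕ) (hN : 0 < N) (c : ℤ) (S : Finset ℕ)
    (hS : ∀ y ∈ S, y < N ∧ Nat.Coprime y N) :
    ∑' k : ℤ, w x k * ((S.filter (fun y : ℕ => (N : ℤ) ∣ k * y + c)).card : ℝ≥0∞) ≤ Z x := by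
  set G := Int.gcd c N with hG
  have hG0 : 0 < G := Int.gcd_pos_of_ne_zero_right _ (by exact_mod_cast hN.ne')
  have hinj : Function.Injective (fun k : ℤ => (G : ℤ) * k) := fun a b h =>
    mul_left_cancel₀ (by exact_mod_cast hG0.ne') h
  calc _ ≤ ∑' k : ℤ, (if (G : ℤ) ∣ k then (G : ℝ≥0∞) * w x k else 0) := by
        refine ENNReal.tsum_le_tsum fun k => ?_
        have := card_le N hN c k S hS
        rw [← hG] at this
        split_ifs at this ⊢ with h
        · rw [mul_comm]; gcongr
        · simp only [Nat.le_zero] at this; simp [this]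
    _ = ∑' k : ℤ, (if (G : ℤ) ∣ G * k then (G : ℝ≥0∞) * w x (G * k) else 0) := by
        symm
        refine hinj.tsum_eq (f := fun k : ℤ => if (G : ℤ) ∣ k then (G : ℝ≥0∞) * w x k else 0) ?_
        intro k hk
        rw [Function.mem_support] at hk
        obtain ⟨q, hq⟩ : (G : ℤ) ∣ k := by by_contra h; simp [h] at hk
        exact ⟨q, hq.symm⟩
    _ ≤ Z x := by
        refine ENNReal.tsum_le_tsum fun k => ?_
        simp only [dvd_mul_right, if_true]
        exact w_mul_le x hx G hG0 k

noncomputable def W {s : ℕ} (u : Finset (Fin s)) (x : ℝ) (j : Fin s) (k : ℤ) : ℝ≥0∞ :=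
  if j ∈ u then w x k else if k = 0 then 1 else 0

noncomputable def EE {s : ℕ} (N : ℕ) (u : Finset (Fin s)) (x : ℝ) (ξ : Fin s → ℤ) : ℝ≥0∞ :=
  ∑' h : Fin s → ℤ, if (N : ℤ) ∣ ∑ j ∈ u, h j * ξ j then ∏ j, W u x j (h j) else 0

noncomputable def T {s : ℕ} (N : ℕ) (u : Finset (Fin s)) (α : ℝ) (ξ : Fin s → ℤ) : ℝ :=
  ∑' h : {h : Fin s → ℤ //
        (∀ j, j ∈ u ↔ h j ≠ 0) ∧ ((N : ℤ) ∣ ∑ j ∈ u, h j * ξ j)},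
      ∏ j ∈ u, |((h.1 j : ℤ) : ℝ)| ^ (-α)

lemma T_nonneg {s : ℕ} (N : ℕ) (u : Finset (Fin s)) (α : ℝ) (ξ : Fin s → ℤ) :
    0 ≤ T N u α ξ :=
  tsum_nonneg fun h => Finset.prod_nonneg fun j _ => by positivity

lemma T_congr {s : ℕ} (N : ℕ) (u : Finset (Fin s)) (α : ℝ) (ξ ξ' : Fin s → ℤ)
    (h : ∀ j ∈ u, ξ j = ξ' j) : T N u α ξ = T N u α ξ' := by
  have h2 : ∀ g : Fin s → ℤ, ∑ j ∈ u, g j * ξ j = ∑ j ∈ u, g j * ξ' j := fun g =>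
    Finset.sum_congr rfl fun j hj => by rw [h j hj]
  unfold T
  rw [← (Equiv.subtypeEquivRight (fun g : Fin s → ℤ =>
    (by rw [h2 g] : ((∀ j, j ∈ u ↔ g j ≠ 0) ∧ ((N : ℤ) ∣ ∑ j ∈ u, g j * ξ j)) ↔
      ((∀ j, j ∈ u ↔ g j ≠ 0) ∧ ((N : ℤ) ∣ ∑ j ∈ u, g j * ξ' j))))).tsum_eq]
  rfl

lemma tsum_W {s : ℕ} (u : Finset (Fin s)) (x : ℝ) (j : Fin s) :
    ∑' k, W u x j k = if j ∈ u then Z x else 1 := by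
  unfold W Z
  split_ifs
  · rfl
  · simp

lemma T_le_EE {s : ℕ} (N : ℕ) (u : Finset (Fin s)) (α lam : ℝ) (ξ : Fin s → ℤ)
    (h0 : 0 < lam) (h1 : lam ≤ 1) :
    ENNReal.ofReal (T N u α ξ) ^ lam ≤ EE N u (α * lam) ξ := by
  unfold T EE
  refine (ENNReal.rpow_le_rpow (ofReal_tsum_le _ fun h => Finset.prod_nonneg fun j _ => by
    positivity) h0.le).trans ?_
  refine (rpow_tsum_le _ h0 h1).trans ?_
  refine le_trans (le_of_eq ?_) (ENNReal.tsum_comp_le_tsum_of_injective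
    (f := (Subtype.val : {h : Fin s → ℤ //
        (∀ j, j ∈ u ↔ h j ≠ 0) ∧ ((N : ℤ) ∣ ∑ j ∈ u, h j * ξ j)} → (Fin s → ℤ)))
    Subtype.val_injective _)
  congr 1
  funext h
  obtain ⟨h, hu, hd⟩ := h
  simp only [hd, if_true]
  rw [ENNReal.ofReal_prod_of_nonneg (fun j _ => by positivity),
    ← ENNReal.prod_rpow_of_nonneg h0.le,
    ← Finset.prod_subset (Finset.subset_univ u)]
  · refine Finset.prod_congr rfl fun j hj => ?_
    rw [W, if_pos hj, w, if_neg ((hu j).1 hj), ENNReal.ofReal_rpow_of_nonneg (by positivity) h0.le,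
      ← Real.rpow_mul (by positivity), neg_mul]
  · intro j _ hj
    have : h j = 0 := by by_contra hh; exact hj ((hu j).2 hh)
    simp [W, hj, this]

lemma avg_le {s : ℕ} (N : ℕ) (hN : 0 < N) (u : Finset (Fin s)) (x : ℝ) (hx : 1 ≤ x)
    (d : Fin s) (hd : d ∈ u) (S : Finset ℕ)
    (hS : ∀ y ∈ S, y < N ∧ Nat.Coprime y N) (ξ : Fin s → ℤ) (V : ℕ → Fin s → ℤ)
    (hV : ∀ y, V y d = y) (hV' : ∀ y j, j ≠ d → V y j = ξ j) :
    ∑ y ∈ S, EE N u x (V y) ≤ Z x ^ u.card := by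
  unfold EE
  rw [← Summable.tsum_finsetSum (fun _ _ => ENNReal.summable)]
  rw [← (Equiv.funSplitAt d ℤ).symm.tsum_eq, ENNReal.tsum_prod', ENNReal.tsum_comm]
  set c : ({j // j ≠ d} → ℤ) → ℤ := fun r =>
    ∑ j ∈ u.erase d, ((Equiv.funSplitAt d ℤ).symm (0, r)) j * ξ j with hc
  have hsum : ∀ (k : ℤ) (r : {j // j ≠ d} → ℤ) (y : ℕ),
      ∑ j ∈ u, ((Equiv.funSplitAt d ℤ).symm (k, r)) j * V y j = k * y + c r := by
    intro k r y
    rw [← Finset.add_sum_erase u _ hd, hV, hc]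
    congr 1
    · simp [Equiv.funSplitAt, Equiv.piSplitAt]
    · refine Finset.sum_congr rfl fun j hj => ?_
      have hj := Finset.ne_of_mem_erase hj
      rw [hV' _ _ hj]
      simp [Equiv.funSplitAt, Equiv.piSplitAt, hj]
  have hprod : ∀ (k : ℤ) (r : {j // j ≠ d} → ℤ),
      ∏ j, W u x j (((Equiv.funSplitAt d ℤ).symm (k, r)) j) =
        w x k * ∏ j : {j // j ≠ d}, W u x j (r j) := by
    intro k r
    rw [Fintype.prod_eq_mul_prod_subtype_ne _ d]
    congr 1
    · simp [Equiv.funSplitAt, Equiv.piSplitAt, W, hd]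
    · refine Finset.prod_congr rfl fun j _ => ?_
      simp [Equiv.funSplitAt, Equiv.piSplitAt, j.2]
  simp_rw [hsum, hprod]
  calc _ = ∑' r : {j // j ≠ d} → ℤ, (∏ j : {j // j ≠ d}, W u x j (r j)) *
        ∑' k : ℤ, w x k * ((S.filter (fun y : ℕ => (N : ℤ) ∣ k * y + c r)).card : ℝ≥0∞) := by
        congr 1
        funext r
        rw [← ENNReal.tsum_mul_left]
        congr 1
        funext k
        rw [← Finset.sum_filter, Finset.sum_const, nsmul_eq_mul]
        ring
    _ ≤ ∑' r : {j // j ≠ d} → ℤ, (∏ j : {j // j ≠ d}, W u x j (r j)) * Z x := by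
        refine ENNReal.tsum_le_tsum fun r => ?_
        gcongr
        exact inner_le x hx N hN (c r) S hS
    _ = ∏ j, ∑' k, W u x j k := by
        rw [ENNReal.tsum_mul_right, tsum_pi_prod (fun j : {j // j ≠ d} => W u x j),
          Fintype.prod_eq_mul_prod_subtype_ne (fun j => ∑' k, W u x j k) d, tsum_W u x d,
          if_pos hd, mul_comm]
    _ = Z x ^ u.card := by
        simp_rw [tsum_W]
        simp

lemma korobov_eq {s : ℕ} (N : ℕ) (α : ℝ) (γ : Finset (Fin s) → ℝ) (ξ : Fin s → ℤ) :
    korobovErrSq N s α γ ξ =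
      ∑ u ∈ Finset.univ.powerset.filter (fun u => u ≠ ∅), γ u * T N u α ξ := rfl

/-- the part of the error over sets containing `d` -/
noncomputable def B {s : ℕ} (N : ℕ) (α : ℝ) (γ : Finset (Fin s) → ℝ) (d : Fin s)
    (ξ : Fin s → ℤ) : ℝ :=
  ∑ u ∈ Finset.univ.powerset.filter (fun u => d ∈ u), γ u * T N u α ξ

lemma korobov_split {s : ℕ} (N : ℕ) (α : ℝ) (γ : Finset (Fin s) → ℝ) (d : Fin s)
    (ξ : Fin s → ℤ) :
    korobovErrSq N s α γ ξ = B N α γ d ξ +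
      ∑ u ∈ Finset.univ.powerset.filter (fun u => u ≠ ∅ ∧ d ∉ u), γ u * T N u α ξ := by
  rw [korobov_eq, B, ← Finset.sum_filter_add_sum_filter_not _ (fun u => d ∈ u),
    Finset.filter_filter, Finset.filter_filter]
  congr 1
  refine Finset.sum_congr ?_ fun _ _ => rfl
  ext u
  simp only [Finset.mem_filter, and_congr_right_iff]
  intro _
  exact ⟨fun h => h.2, fun h => ⟨Finset.ne_empty_of_mem h, h⟩⟩

lemma B_nonneg {s : ℕ} (N : ℕ) (α : ℝ) (γ : Finset (Fin s) → ℝ) (hγ : ∀ u, 0 < γ u)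
    (d : Fin s) (ξ : Fin s → ℤ) : 0 ≤ B N α γ d ξ :=
  Finset.sum_nonneg fun u _ => mul_nonneg (hγ u).le (T_nonneg _ _ _ _)

lemma step_le (b m s : ℕ) (hb : Nat.Prime b) (hm : 0 < m)
    (N : ℕ) (hN : N = b ^ m) (α : ℝ)
    (γ : Finset (Fin s) → ℝ) (hγ : ∀ u, 0 < γ u) (d : Fin s) (ξ : Fin s → ℤ)
    (V : ℕ → Fin s → ℤ) (hV : ∀ y, V y d = y) (hV' : ∀ y j, j ≠ d → V y j = ξ j)
    (z : ℕ) (hmin : ∀ y ∈ fullSearch b m,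
        korobovErrSq N s α γ (V z) ≤ korobovErrSq N s α γ (V y))
    (lam : ℝ) (h0 : 0 < lam) (h1 : lam ≤ 1) (hx : 1 < α * lam) :
    B N α γ d (V z) ^ lam ≤ ∑ u ∈ Finset.univ.powerset.filter (fun u => d ∈ u),
            (γ u) ^ lam * (2 * (2 * rzeta (α * lam)) ^ u.card) / (b : ℝ) ^ m := by
  have hN0 : 0 < N := hN ▸ pow_pos hb.pos m
  have hN1 : 1 < N := hN ▸ Nat.one_lt_pow hm.ne' hb.one_lt
  set S : Finset ℕ := (Finset.range N).filter (fun y => Nat.Coprime N y) with hSdef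
  have hScard : S.card = N.totient := by rw [Nat.totient]
  have hS : ∀ y ∈ S, y < N ∧ Nat.Coprime y N := by
    intro y hy
    simp only [hSdef, Finset.mem_filter, Finset.mem_range] at hy
    exact ⟨hy.1, hy.2.symm⟩
  have hSF : ∀ y ∈ S, y ∈ fullSearch b m := by
    intro y hy
    obtain ⟨h1, h2⟩ := hS y hy
    refine ⟨Nat.pos_of_ne_zero ?_, hN ▸ h1, hN ▸ h2⟩
    rintro rfl
    rw [Nat.coprime_zero_left] at h2
    omega
  have htot : N ≤ 2 * N.totient := by
    rw [hN, Nat.totient_prime_pow hb hm]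
    have h2 := hb.two_le
    calc b ^ m = b ^ (m - 1) * b := by rw [← pow_succ, Nat.sub_add_cancel hm]
      _ ≤ b ^ (m - 1) * (2 * (b - 1)) := by gcongr; omega
      _ = _ := by ring
  have htot0 : 0 < N.totient := Nat.totient_pos.2 hN0
  have hB : ∀ y ∈ S, B N α γ d (V z) ≤ B N α γ d (V y) := by
    intro y hy
    have h := hmin y (hSF y hy)
    rw [korobov_split N α γ d, korobov_split N α γ d] at h
    have heq : ∑ u ∈ Finset.univ.powerset.filter (fun u => u ≠ ∅ ∧ d ∉ u), γ u * T N u α (V z) =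
        ∑ u ∈ Finset.univ.powerset.filter (fun u => u ≠ ∅ ∧ d ∉ u), γ u * T N u α (V y) := by
      refine Finset.sum_congr rfl fun u hu => ?_
      rw [T_congr N u α (V z) (V y)]
      intro j hj
      have : j ≠ d := by rintro rfl; exact (Finset.mem_filter.1 hu).2.2 hj
      rw [hV' _ _ this, hV' _ _ this]
    linarith
  have hBE : ∀ y, ENNReal.ofReal (B N α γ d (V y)) ^ lam ≤
      ∑ u ∈ Finset.univ.powerset.filter (fun u => d ∈ u),
        ENNReal.ofReal (γ u ^ lam) * EE N u (α * lam) (V y) := by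
    intro y
    rw [B, ENNReal.ofReal_sum_of_nonneg (fun u _ => mul_nonneg (hγ u).le (T_nonneg _ _ _ _))]
    refine (rpow_sum_le _ _ h0 h1).trans (Finset.sum_le_sum fun u _ => ?_)
    rw [ENNReal.ofReal_mul (hγ u).le, ENNReal.mul_rpow_of_nonneg _ _ h0.le,
      ENNReal.ofReal_rpow_of_nonneg (hγ u).le h0.le]
    gcongr
    exact T_le_EE N u α lam (V y) h0 h1
  have hz : 0 ≤ 2 * rzeta (α * lam) := mul_nonneg zero_le_two (rzeta_nonneg _)
  have main : (N.totient : ℝ≥0∞) * ENNReal.ofReal (B N α γ d (V z)) ^ lam ≤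
      ∑ u ∈ Finset.univ.powerset.filter (fun u => d ∈ u),
        ENNReal.ofReal (γ u ^ lam) * ENNReal.ofReal (2 * rzeta (α * lam)) ^ u.card := by
    calc _ = ∑ y ∈ S, ENNReal.ofReal (B N α γ d (V z)) ^ lam := by
          rw [Finset.sum_const, hScard, nsmul_eq_mul]
      _ ≤ ∑ y ∈ S, ∑ u ∈ Finset.univ.powerset.filter (fun u => d ∈ u),
        ENNReal.ofReal (γ u ^ lam) * EE N u (α * lam) (V y) := by
          refine Finset.sum_le_sum fun y hy => (ENNReal.rpow_le_rpow ?_ h0.le).trans (hBE y)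
          exact ENNReal.ofReal_le_ofReal (hB y hy)
      _ = ∑ u ∈ Finset.univ.powerset.filter (fun u => d ∈ u),
        ENNReal.ofReal (γ u ^ lam) * ∑ y ∈ S, EE N u (α * lam) (V y) := by
          rw [Finset.sum_comm]
          simp_rw [Finset.mul_sum]
      _ ≤ _ := by
          refine Finset.sum_le_sum fun u hu => ?_
          gcongr
          rw [← Z_eq _ hx]
          exact avg_le N hN0 u _ hx.le d (Finset.mem_filter.1 hu).2 S hS ξ V hV hV'
  have mainR : (N.totient : ℝ) * B N α γ d (V z) ^ lam ≤
      ∑ u ∈ Finset.univ.powerset.filter (fun u => d ∈ u),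
        γ u ^ lam * (2 * rzeta (α * lam)) ^ u.card := by
    have hn : ∀ u ∈ Finset.univ.powerset.filter (fun u : Finset (Fin s) => d ∈ u),
        0 ≤ γ u ^ lam * (2 * rzeta (α * lam)) ^ u.card := fun u _ =>
      mul_nonneg (Real.rpow_nonneg (hγ u).le _) (pow_nonneg hz _)
    rw [← ENNReal.ofReal_le_ofReal_iff (Finset.sum_nonneg hn), ENNReal.ofReal_sum_of_nonneg hn,
      ENNReal.ofReal_mul (by positivity), ENNReal.ofReal_natCast,
      ← ENNReal.ofReal_rpow_of_nonneg (B_nonneg N α γ hγ d _) h0.le]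
    refine main.trans (le_of_eq (Finset.sum_congr rfl fun u _ => ?_))
    rw [ENNReal.ofReal_mul (Real.rpow_nonneg (hγ u).le _), ENNReal.ofReal_pow hz]
  have hbN : (b : ℝ) ^ m = N := by rw [hN]; push_cast; rfl
  rw [hbN, ← Finset.sum_div, le_div_iff₀ (by exact_mod_cast hN0)]
  have hBl : 0 ≤ B N α γ d (V z) ^ lam := Real.rpow_nonneg (B_nonneg N α γ hγ d _) _
  calc _ ≤ B N α γ d (V z) ^ lam * (2 * N.totient) := by
        gcongr; exact_mod_cast htot
    _ = 2 * (N.totient * B N α γ d (V z) ^ lam) := by ring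
    _ ≤ 2 * ∑ u ∈ Finset.univ.powerset.filter (fun u => d ∈ u),
        γ u ^ lam * (2 * rzeta (α * lam)) ^ u.card := by gcongr
    _ = _ := by
        rw [Finset.mul_sum]
        refine Finset.sum_congr rfl fun u _ => by ring

lemma korobov_le {s : ℕ} (N : ℕ) (α : ℝ) (γ : Finset (Fin s) → ℝ) (hγ : ∀ u, 0 < γ u)
    (ξ : Fin s → ℤ) (X : Fin s → Fin s → ℤ) (hX : ∀ d j, j ≤ d → X d j = ξ j) :
    korobovErrSq N s α γ ξ ≤ ∑ d, B N α γ d (X d) := by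
  rw [korobov_eq]
  simp only [B, Finset.sum_filter]
  rw [Finset.sum_comm]
  refine Finset.sum_le_sum fun u _ => ?_
  have hn : ∀ d, 0 ≤ if d ∈ u then γ u * T N u α (X d) else 0 := fun d => by
    split_ifs
    · exact mul_nonneg (hγ u).le (T_nonneg _ _ _ _)
    · exact le_rfl
  split_ifs with hu
  · have hne := Finset.nonempty_iff_ne_empty.2 hu
    refine le_trans (le_of_eq ?_)
      (Finset.single_le_sum (fun d _ => hn d) (Finset.mem_univ (u.max' hne)))
    rw [if_pos (u.max'_mem hne), T_congr N u α ξ (X (u.max' hne))]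
    intro j hj
    rw [hX _ _ (u.le_max' j hj)]
  · exact Finset.sum_nonneg fun d _ => hn d

lemma real_rpow_sum_le {ι : Type*} (s : Finset ι) (f : ι → ℝ) (hf : ∀ i, 0 ≤ f i) {p : ℝ}
    (hp : 0 < p) (hp1 : p ≤ 1) :
    (∑ i ∈ s, f i) ^ p ≤ ∑ i ∈ s, f i ^ p := by
  classical
  induction s using Finset.induction_on with
  | empty => simp [hp.ne']
  | insert a s ha ih =>
    rw [Finset.sum_insert ha, Finset.sum_insert ha]
    exact (Real.rpow_add_le_add_rpow (hf a) (Finset.sum_nonneg fun i _ => hf i) hp.le hp1).trans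
      (by gcongr)

end SCSAux

theorem SCS_general_weights (b m s : ℕ) (hb : Nat.Prime b) (hm : 0 < m) (hs : 0 < s)
    (N : ℕ) (hN : N = b ^ m) (α : ℝ) (hα : 1 < α)
    (γ : Finset (Fin s) → ℝ) (hγ : ∀ u, 0 < γ u)
    (z0 : Fin s → ℤ) (z : Fin s → ℕ)
    -- the vector considered in step `d` of the algorithm, with candidate `y` in place `d`:
    (v : Fin s → ℕ → (Fin s → ℤ))
    (hv : ∀ d y j, v d y j =
      if j < d then (z j : ℤ) else if j = d then (y : ℤ) else z0 j)
    -- each component is chosen from the full search space, minimizing the error: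
    (halg : ∀ d : Fin s, z d ∈ fullSearch b m ∧
      ∀ y ∈ fullSearch b m,
        korobovErrSq N s α γ (v d (z d)) ≤ korobovErrSq N s α γ (v d y)) :
    (∀ lam : ℝ, 1 / α < lam → lam ≤ 1 →
      korobovErrSq N s α γ (fun j => (z j : ℤ)) ≤
        (∑ d : Fin s, ∑ u ∈ Finset.univ.powerset.filter (fun u => d ∈ u),
            (γ u) ^ lam * (2 * (2 * rzeta (α * lam)) ^ u.card) / (b : ℝ) ^ m)
          ^ (1 / lam)) ∧
    -- in particular, a convergence rate `N^{-α/2+δ}` with a constant independent of `s`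
    -- whenever the corresponding weight sum is bounded uniformly in `s`:
    (∀ δ : ℝ, 0 < δ → δ ≤ (α - 1) / 2 → ∀ C : ℝ,
      2 * (∑ d : Fin s, ∑ u ∈ Finset.univ.powerset.filter (fun u => d ∈ u),
          (γ u) ^ (1 / (α - 2 * δ)) * (2 * rzeta (α / (α - 2 * δ))) ^ u.card) ≤ C →
      Real.sqrt (korobovErrSq N s α γ (fun j => (z j : ℤ))) ≤
        C ^ (α / 2 - δ) * (N : ℝ) ^ (-(α / 2) + δ)) := by 
  have hN0 : 0 < N := hN ▸ pow_pos hb.pos m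
  have part1 : ∀ lam : ℝ, 1 / α < lam → lam ≤ 1 →
      korobovErrSq N s α γ (fun j => (z j : ℤ)) ≤
        (∑ d : Fin s, ∑ u ∈ Finset.univ.powerset.filter (fun u => d ∈ u),
            (γ u) ^ lam * (2 * (2 * rzeta (α * lam)) ^ u.card) / (b : ℝ) ^ m)
          ^ (1 / lam) := by
    intro lam hl hl1
    have hα0 : 0 < α := by linarith
    have h0 : 0 < lam := lt_trans (by positivity) hl
    have hx : 1 < α * lam := by rwa [div_lt_iff₀ hα0, mul_comm] at hl
    have hBn : ∀ d, 0 ≤ SCSAux.B N α γ d (v d (z d)) := fun d => SCSAux.B_nonneg N α γ hγ d _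
    have hle : korobovErrSq N s α γ (fun j => (z j : ℤ)) ≤
        ∑ d, SCSAux.B N α γ d (v d (z d)) := by
      refine SCSAux.korobov_le N α γ hγ _ (fun d => v d (z d)) fun d j hj => ?_
      simp only [hv]
      rcases hj.lt_or_eq with h | h
      · simp [h]
      · simp [h]
    refine hle.trans ?_
    rw [one_div, Real.le_rpow_inv_iff_of_pos (Finset.sum_nonneg fun d _ => hBn d) ?_ h0]
    · refine (SCSAux.real_rpow_sum_le _ _ hBn h0 hl1).trans (Finset.sum_le_sum fun d _ => ?_)
      refine SCSAux.step_le b m s hb hm N hN α γ hγ d (v d 0) (v d) ?_ ?_ (z d) (halg d).2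
        lam h0 hl1 hx
      · intro y; simp [hv]
      · intro y j hj; simp [hv, hj]
    · refine Finset.sum_nonneg fun d _ => Finset.sum_nonneg fun u _ => ?_
      have h1 := (hγ u).le
      have h2 := SCSAux.rzeta_nonneg (α * lam)
      positivity
  refine ⟨part1, ?_⟩
  intro δ hδ hδ1 C hC
  have hp : 1 ≤ α - 2 * δ := by linarith
  have hp0 : 0 < α - 2 * δ := by linarith
  have h := part1 (1 / (α - 2 * δ)) (one_div_lt_one_div_of_lt hp0 (by linarith))
    (by rw [div_le_one hp0]; exact hp)
  rw [one_div_one_div, mul_one_div] at h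
  have hNR : (0 : ℝ) < N := by exact_mod_cast hN0
  have hbN : (b : ℝ) ^ m = N := by rw [hN]; push_cast; rfl
  set Q := ∑ d : Fin s, ∑ u ∈ Finset.univ.powerset.filter (fun u => d ∈ u),
          (γ u) ^ (1 / (α - 2 * δ)) * (2 * rzeta (α / (α - 2 * δ))) ^ u.card with hQ
  have hQ0 : 0 ≤ Q := by
    refine Finset.sum_nonneg fun d _ => Finset.sum_nonneg fun u _ => ?_
    have h1 := (hγ u).le
    have h2 := SCSAux.rzeta_nonneg (α / (α - 2 * δ))
    positivity
  have hC0 : 0 ≤ C := by linarith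
  have hS : (∑ d : Fin s, ∑ u ∈ Finset.univ.powerset.filter (fun u => d ∈ u),
      (γ u) ^ (1 / (α - 2 * δ)) * (2 * (2 * rzeta (α / (α - 2 * δ))) ^ u.card) / (b : ℝ) ^ m)
      = 2 * Q / N := by
    rw [hQ, hbN, Finset.mul_sum, Finset.sum_div]
    refine Finset.sum_congr rfl fun d _ => ?_
    rw [Finset.mul_sum, Finset.sum_div]
    exact Finset.sum_congr rfl fun u _ => by ring
  rw [hS] at h
  have h2 : korobovErrSq N s α γ (fun j => (z j : ℤ)) ≤ (C / N) ^ (α - 2 * δ) :=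
    h.trans (Real.rpow_le_rpow (by positivity) (by gcongr) hp0.le)
  refine (Real.sqrt_le_sqrt h2).trans (le_of_eq ?_)
  rw [Real.sqrt_eq_rpow, ← Real.rpow_mul (by positivity), Real.div_rpow hC0 hNR.le,
    show -(α / 2) + δ = -((α - 2 * δ) * (1 / 2)) by ring, Real.rpow_neg hNR.le,
    show α / 2 - δ = (α - 2 * δ) * (1 / 2) by ring, div_eq_mul_inv]
end
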